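/- arXiv:2207.03165 — 4 statements merged into one kernel-verified Lean document; each statement's English description precedes it below -/
import Mathlib

section
/- Let l > 2 be a positive integer with 3 dividing l. Then n(4,l) = 8l/3 + 1; that is, every element of A_{8l/3+1} is a product of four l-cycles of S_{8l/3+1}, and for every n > 8l/3+1 there exists an element of A_n that is not a product of four l-cycles of S_n. -/
open Equiv

/-- `σ ∈ S_n` is a product of `k` many `l`-cycles. -/
def IsProdOfCycles (n k l : ℕ) (σ : Equiv.Perm (Fin n)) : Prop :=
  ∃ c : Fin k → Equiv.Perm (Fin n),
    (∀ i, (c i).IsCycle ∧ (c i).support.card = l) ∧ σ = (List.ofFn c).prod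

namespace FourCycles

set_option linter.unusedSectionVars false

section Part1

variable {α : Type*} [Fintype α] [DecidableEq α]

/-- `c` is a cyclic permutation of the points of `S` (with `|S| = 1` allowed). -/
def CycOn (c : Perm α) (S : Finset α) : Prop :=
  ∃ L : List α, L.Nodup ∧ L.toFinset = S ∧ L.formPerm = c

theorem formPerm_app (q : α) (B : List α) : ∀ A : List α,
    (A ++ q :: B).formPerm = (A ++ [q]).formPerm * (q :: B).formPerm
  | [] => by simp
  | [x] => by simp [List.formPerm_cons_cons]
  | x :: y :: A => by
    have := formPerm_app q B (y :: A)
    simp only [List.cons_append] at this ⊢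
    rw [List.formPerm_cons_cons, this, List.formPerm_cons_cons, mul_assoc]

theorem rot_formPerm (p : α) (A : List α) (h : (p :: A).Nodup) :
    (A ++ [p]).formPerm = (p :: A).formPerm := by
  have := List.formPerm_rotate_one (p :: A) h
  simpa using this

theorem CycOn.head {c : Perm α} {S : Finset α} (h : CycOn c S) {p : α} (hp : p ∈ S) :
    ∃ A : List α, (p :: A).Nodup ∧ (p :: A).toFinset = S ∧ (p :: A).formPerm = c := by
  obtain ⟨L, hL, rfl, rfl⟩ := h
  have hp' : p ∈ L := by simpa using hp
  obtain ⟨s, t, rfl⟩ := List.append_of_mem hp'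
  have hr : (s ++ p :: t) ~r (p :: t ++ s) := List.isRotated_append
  refine ⟨t ++ s, ?_, ?_, ?_⟩
  · simpa using hr.nodup_iff.1 hL
  · ext x; simp; tauto
  · have := List.formPerm_eq_of_isRotated hL hr
    simpa using this.symm

theorem CycOn.join {c g : Perm α} {S T : Finset α} (hc : CycOn c S) (hg : CycOn g T)
    (hd : Disjoint S T) {p q : α} (hp : p ∈ S) (hq : q ∈ T) :
    CycOn (c * g * swap p q) (S ∪ T) := by
  obtain ⟨A, hA, rfl, rfl⟩ := hc.head hp
  obtain ⟨B, hB, rfl, rfl⟩ := hg.head hq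
  rw [Finset.disjoint_left] at hd
  have hdd : ∀ x, x ∈ p :: A → x ∉ q :: B := fun x hx hx' => hd (by simpa using hx) (by simpa using hx')
  have hN : (p :: (B ++ [q])).Nodup := by
    have h1 := hdd p (by simp)
    simp only [List.nodup_cons, List.nodup_append, List.mem_cons, List.mem_append] at hB h1 ⊢
    grind
  refine ⟨A ++ p :: (B ++ [q]), ?_, ?_, ?_⟩
  · rw [List.nodup_append]
    refine ⟨(List.nodup_cons.1 hA).2, hN, ?_⟩
    intro a ha b hb
    have h1 := hdd a (by simp [ha])
    simp only [List.nodup_cons] at hA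
    simp only [List.mem_cons, List.mem_append] at hb h1
    grind
  · ext x; simp; tauto
  · rw [formPerm_app, rot_formPerm p A hA, ← rot_formPerm p (B ++ [q]) hN, mul_assoc,
      List.append_assoc, List.singleton_append, formPerm_app, rot_formPerm q B hB,
      List.formPerm_pair, swap_comm]

theorem CycOn.inv {c : Perm α} {S : Finset α} (hc : CycOn c S) : CycOn c⁻¹ S := by
  obtain ⟨L, hL, rfl, rfl⟩ := hc
  exact ⟨L.reverse, by simpa using hL, by simp, List.formPerm_reverse L⟩

theorem CycOn.join' {c g : Perm α} {S T : Finset α} (hc : CycOn c S) (hg : CycOn g T)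
    (hd : Disjoint S T) {p q : α} (hp : p ∈ S) (hq : q ∈ T) :
    CycOn (swap p q * g * c) (S ∪ T) := by
  have := (hc.inv.join hg.inv hd hp hq).inv
  simpa [mul_assoc] using this

theorem cycOn_one (p : α) : CycOn (1 : Perm α) {p} := ⟨[p], by simp, by simp, by simp⟩

theorem cycOn_of_isCycle {c : Perm α} (hc : c.IsCycle) : CycOn c c.support := by
  obtain ⟨x, hx, _⟩ := id hc
  refine ⟨c.toList x, Perm.nodup_toList c x, ?_, ?_⟩
  · ext y
    rw [List.mem_toFinset, Perm.mem_toList_iff, Perm.mem_support]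
    constructor
    · rintro ⟨h1, h2⟩
      rw [← Perm.mem_support] at *
      exact (h1.mem_support_iff).1 h2
    · intro hy
      exact ⟨hc.sameCycle hx (Perm.mem_support.1 hy), by simpa using hx⟩
  · rw [Perm.formPerm_toList, hc.cycleOf_eq hx]

theorem CycOn.isCycle {c : Perm α} {S : Finset α} (hc : CycOn c S) (h2 : 2 ≤ S.card) :
    c.IsCycle ∧ c.support = S := by
  obtain ⟨L, hL, rfl, rfl⟩ := hc
  rw [List.toFinset_card_of_nodup hL] at h2
  refine ⟨List.isCycle_formPerm hL h2, List.support_formPerm_of_nodup L hL ?_⟩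
  rintro x rfl
  simp at h2

theorem CycOn.cut {c : Perm α} {S : Finset α} (hc : CycOn c S) {i j : ℕ} (hi : 1 ≤ i) (hj : 1 ≤ j)
    (hij : i + j = S.card + 1) :
    ∃ (c₁ c₂ : Perm α) (S₁ S₂ : Finset α) (q : α), CycOn c₁ S₁ ∧ CycOn c₂ S₂ ∧ S₁.card = i ∧
      S₂.card = j ∧ S₁ ⊆ S ∧ S₂ ⊆ S ∧ q ∈ S₁ ∧ q ∈ S₂ ∧ c = c₁ * c₂ := by
  obtain ⟨L, hL, rfl, rfl⟩ := hc
  rw [List.toFinset_card_of_nodup hL] at hij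
  obtain ⟨A, q, B, rfl, hA⟩ : ∃ A q B, L = A ++ q :: B ∧ A.length = i - 1 := by
    refine ⟨L.take (i-1), L[i-1], L.drop (i - 1 + 1), ?_, ?_⟩
    · rw [List.getElem_cons_drop, List.take_append_drop]
    · simp; omega
  have h1 : (A ++ [q]).Nodup := by
    refine hL.sublist ?_
    exact List.Sublist.append_left (by simp) A
  have h2 : (q :: B).Nodup := hL.sublist (by simp)
  simp at hij
  refine ⟨_, _, _, _, q, ⟨A ++ [q], h1, rfl, rfl⟩, ⟨q :: B, h2, rfl, rfl⟩, ?_, ?_, ?_, ?_, ?_, ?_,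
    formPerm_app q B A⟩
  · rw [List.toFinset_card_of_nodup h1]; simp; omega
  · rw [List.toFinset_card_of_nodup h2]; simp; omega
  · intro x; simp; tauto
  · intro x; simp; tauto
  · simp
  · simp

theorem CycOn.snoc {c : Perm α} {S : Finset α} (hc : CycOn c S) {p x : α} (hp : p ∈ S)
    (hx : x ∉ S) : ∃ S', CycOn (c * swap p x) S' ∧ S'.card = S.card + 1 := by
  refine ⟨S ∪ {x}, ?_, ?_⟩
  · simpa using hc.join (cycOn_one x) (by simpa using hx) hp (by simp)
  · rw [Finset.card_union_of_disjoint (by simpa using hx)]; simp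

theorem CycOn.cons {c : Perm α} {S : Finset α} (hc : CycOn c S) {p x : α} (hp : p ∈ S)
    (hx : x ∉ S) : ∃ S', CycOn (swap p x * c) S' ∧ S'.card = S.card + 1 := by
  refine ⟨S ∪ {x}, ?_, ?_⟩
  · simpa using hc.join' (cycOn_one x) (by simpa using hx) hp (by simp)
  · rw [Finset.card_union_of_disjoint (by simpa using hx)]; simp

/-- The product of two cyclic permutations of sizes `a`, `b`. -/
def Two (σ : Perm α) (a b : ℕ) : Prop :=
  ∃ (c d : Perm α) (S T : Finset α), CycOn c S ∧ CycOn d T ∧ S.card = a ∧ T.card = b ∧ σ = c * d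

theorem Two.raise1 {σ : Perm α} {a b : ℕ} (h : Two σ a b) (ha : 1 ≤ a) (hb : 1 ≤ b)
    (ha' : a < Fintype.card α) (hb' : b < Fintype.card α) : Two σ (a + 1) (b + 1) := by
  obtain ⟨c, d, S, T, hc, hd, rfl, rfl, rfl⟩ := h
  have key : ∀ p x : α, (p ∈ S ∧ x ∉ S) → ((p ∈ T ∧ x ∉ T) ∨ (x ∈ T ∧ p ∉ T)) →
      Two (c * d) (S.card + 1) (T.card + 1) := by
    rintro p x ⟨h1, h2⟩ h3
    obtain ⟨S', hS', hS2⟩ := hc.snoc h1 h2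
    obtain ⟨T', hT', hT2⟩ : ∃ S', CycOn (swap p x * d) S' ∧ S'.card = T.card + 1 := by
      rcases h3 with ⟨h3, h4⟩ | ⟨h3, h4⟩
      · exact hd.cons h3 h4
      · rw [swap_comm]; exact hd.cons h3 h4
    refine ⟨_, _, S', T', hS', hT', hS2, hT2, ?_⟩
    simp [mul_assoc]
  have neU : ∀ U : Finset α, U.card < Fintype.card α → ∃ x, x ∉ U := by
    intro U hU
    by_contra hcon
    push Not at hcon
    rw [(Finset.eq_univ_iff_forall).2 hcon, Finset.card_univ] at hU
    omega
  by_cases hST : S ⊆ T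
  · obtain ⟨p, hp⟩ := Finset.card_pos.1 ha
    obtain ⟨x, hx⟩ := neU T hb'
    exact key p x ⟨hp, fun h => hx (hST h)⟩ (Or.inl ⟨hST hp, hx⟩)
  · obtain ⟨p, hp, hpT⟩ := Finset.not_subset.1 hST
    by_cases hTS : T ⊆ S
    · obtain ⟨p, hp⟩ := Finset.card_pos.1 hb
      obtain ⟨x, hx⟩ := neU S ha'
      exact key p x ⟨hTS hp, hx⟩ (Or.inl ⟨hp, fun h => hx (hTS h)⟩)
    · obtain ⟨x, hx, hxS⟩ := Finset.not_subset.1 hTS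
      exact key p x ⟨hp, hxS⟩ (Or.inr ⟨hx, hpT⟩)

theorem Two.raise {σ : Perm α} {a b : ℕ} (h : Two σ a b) (ha : 1 ≤ a) (hb : 1 ≤ b) :
    ∀ k : ℕ, a + k ≤ Fintype.card α → b + k ≤ Fintype.card α → Two σ (a + k) (b + k)
  | 0, _, _ => h
  | k + 1, h1, h2 =>
    (Two.raise h ha hb k (by omega) (by omega)).raise1 (by omega) (by omega) (by omega) (by omega)

/-- weight -/
def wt (σ : Perm α) : ℕ := σ.cycleType.sum + Multiset.card σ.cycleType

theorem wt_one : wt (1 : Perm α) = 0 := by simp [wt]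

theorem wt_mul {σ τ : Perm α} (h : σ.Disjoint τ) : wt (σ * τ) = wt σ + wt τ := by
  simp [wt, h.cycleType_mul]; omega

theorem wt_cycle {σ : Perm α} (h : σ.IsCycle) : wt σ = σ.support.card + 1 := by
  simp [wt, h.cycleType]

theorem balanced (σ : Perm α) : σ ≠ 1 → ∀ a b, a + b = wt σ → a ≤ b + 1 → b ≤ a + 1 →
    ∃ (c d : Perm α) (S T : Finset α) (p : α), CycOn c S ∧ CycOn d T ∧ S.card = a ∧ T.card = b ∧
      S ⊆ σ.support ∧ T ⊆ σ.support ∧ p ∈ S ∧ p ∈ T ∧ σ = c * d := by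
  induction σ using Perm.cycle_induction_on with
  | base_one => intro h; exact absurd rfl h
  | base_cycles σ hσ =>
    intro _ a b hab h1 h2
    rw [wt_cycle hσ] at hab
    have := hσ.two_le_card_support
    obtain ⟨c₁, c₂, S₁, S₂, q, h⟩ := (cycOn_of_isCycle hσ).cut (i := a) (j := b)
      (by omega) (by omega) hab
    exact ⟨c₁, c₂, S₁, S₂, q, h⟩
  | induction_disjoint σ τ hd hσ ih1 ih2 =>
    intro _ a b hab h1 h2
    by_cases hτ : τ = 1
    · subst hτ
      simp only [mul_one] at *
      exact ih1 hσ.ne_one a b hab h1 h2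
    rw [wt_mul hd, wt_cycle hσ] at hab
    have h2s := hσ.two_le_card_support
    obtain ⟨c, d, S, T, p, hc, hdd, hS, hT, hSs, hTs, hpS, hpT, he⟩ :=
      ih2 hτ (wt τ / 2) ((wt τ + 1) / 2) (by omega) (by omega) (by omega)
    obtain ⟨e, f, U, V, q, hee, hf, hU, hV, hUs, hVs, hqU, hqV, he'⟩ :=
      (cycOn_of_isCycle hσ).cut (i := a - wt τ / 2) (j := b - (wt τ + 1) / 2)
      (by omega) (by omega) (by omega)
    have hdis : _root_.Disjoint τ.support σ.support := hd.disjoint_support.symm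
    have dSU : _root_.Disjoint S U := hdis.mono hSs hUs
    have dTV : _root_.Disjoint T V := hdis.mono hTs hVs
    refine ⟨c * e * swap p q, swap p q * f * d, S ∪ U, T ∪ V, p, hc.join hee dSU hpS hqU,
      hdd.join' hf dTV hpT hqV, ?_, ?_, ?_, ?_, by simp [hpS], by simp [hpT], ?_⟩
    · rw [Finset.card_union_of_disjoint dSU]; omega
    · rw [Finset.card_union_of_disjoint dTV]; omega
    · rw [hd.support_mul]; exact Finset.union_subset (hSs.trans Finset.subset_union_right)
        (hUs.trans Finset.subset_union_left)
    · rw [hd.support_mul]; exact Finset.union_subset (hTs.trans Finset.subset_union_right)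
        (hVs.trans Finset.subset_union_left)
    · have hcd : c * d * σ = c * σ * d := by
        have : Commute d σ := by
          have : Perm.Disjoint d σ := by
            rw [Perm.disjoint_iff_disjoint_support]
            refine hdis.mono_left (le_trans ?_ hTs)
            obtain ⟨L, -, rfl, rfl⟩ := hdd
            exact List.support_formPerm_le L
          exact this.commute
        rw [mul_assoc, this.eq, mul_assoc]
      rw [hd.commute.eq]
      conv_lhs => rw [he]
      rw [hcd, he']
      simp [mul_assoc]

theorem two_of_wt (σ : Perm α) (a b : ℕ) (h : wt σ ≤ a + b) (hpar : Even (a + b + wt σ))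
    (h1 : a ≤ b + 1) (h2 : b ≤ a + 1) (ha : 1 ≤ a) (hb : 1 ≤ b) (ha' : a ≤ Fintype.card α)
    (hb' : b ≤ Fintype.card α) : Two σ a b := by
  by_cases hσ : σ = 1
  · subst hσ
    rw [wt_one] at hpar
    obtain ⟨k, hk⟩ := hpar
    have hab : a = b := by omega
    subst hab
    obtain ⟨p⟩ : Nonempty α := Fintype.card_pos_iff.1 (by omega)
    have : Two (1 : Perm α) 1 1 := ⟨1, 1, {p}, {p}, cycOn_one p, cycOn_one p, by simp, by simp, by simp⟩
    have := this.raise le_rfl le_rfl (a - 1) (by omega) (by omega)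
    rwa [show 1 + (a - 1) = a by omega] at this
  · obtain ⟨k, hk⟩ := hpar
    have hw : 3 ≤ wt σ := by
      have h1 := Perm.two_le_card_support_of_ne_one hσ
      have h2 := Perm.card_cycleType_pos.2 hσ
      rw [wt, Perm.sum_cycleType]; omega
    obtain ⟨j, hj⟩ : ∃ j, a + b = wt σ + 2 * j := ⟨k - wt σ, by omega⟩
    obtain ⟨c, d, S, T, p, hc, hdd, hS, hT, -, -, -, -, he⟩ := balanced σ hσ (a - j) (b - j)
      (by omega) (by omega) (by omega)
    have : Two σ (a - j) (b - j) := ⟨c, d, S, T, hc, hdd, hS, hT, he⟩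
    have := this.raise (by omega) (by omega) j (by omega) (by omega)
    rwa [show a - j + j = a by omega, show b - j + j = b by omega] at this

theorem split (σ : Perm α) : ∀ M N, wt σ + 2 ≤ M + N → ∃ β γ : Perm α, σ = β * γ ∧
    wt β ≤ M ∧ wt γ ≤ N ∧ β.support ⊆ σ.support ∧ γ.support ⊆ σ.support := by
  have small : ∀ (σ : Perm α) M N, wt σ + 2 ≤ M + N → M ≤ 2 → ∃ β γ : Perm α, σ = β * γ ∧
      wt β ≤ M ∧ wt γ ≤ N ∧ β.support ⊆ σ.support ∧ γ.support ⊆ σ.support := by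
    intro σ M N h hM
    exact ⟨1, σ, by simp, by simp [wt_one], by omega, by simp, by simp⟩
  have step : ∀ σ τ : Perm α, σ.Disjoint τ → σ.IsCycle →
      (∀ M N, wt τ + 2 ≤ M + N → ∃ β γ : Perm α, τ = β * γ ∧
    wt β ≤ M ∧ wt γ ≤ N ∧ β.support ⊆ τ.support ∧ γ.support ⊆ τ.support) →
      ∀ M N, wt (σ * τ) + 2 ≤ M + N → ∃ β γ : Perm α, σ * τ = β * γ ∧
    wt β ≤ M ∧ wt γ ≤ N ∧ β.support ⊆ (σ * τ).support ∧ γ.support ⊆ (σ * τ).support := by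
    intro σ τ hd hσ ih M N hMN
    by_cases hM2 : M ≤ 2
    · exact small _ M N hMN hM2
    have hwm := wt_mul hd
    have hwc := wt_cycle hσ
    have hdis := hd.disjoint_support
    by_cases hz : wt σ ≤ M
    · obtain ⟨β, γ, he, hβ, hγ, hβs, hγs⟩ := ih (M - wt σ) N (by omega)
      have hdβ : σ.Disjoint β := by
        rw [Perm.disjoint_iff_disjoint_support]; exact hdis.mono_right hβs
      refine ⟨σ * β, γ, by rw [he, mul_assoc], by rw [wt_mul hdβ]; omega, hγ, ?_, ?_⟩
      · rw [hdβ.support_mul, hd.support_mul]; exact Finset.union_subset_union_right hβs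
      · rw [hd.support_mul]; exact hγs.trans Finset.subset_union_right
    · obtain ⟨e, f, U, V, q, hee, hf, hU, hV, hUs, hVs, hqU, hqV, he'⟩ :=
        (cycOn_of_isCycle hσ).cut (i := M - 1) (j := wt σ + 1 - M) (by omega) (by omega) (by omega)
      obtain ⟨hec, hes⟩ := hee.isCycle (by omega)
      obtain ⟨hfc, hfs⟩ := hf.isCycle (by omega)
      have hdf : f.Disjoint τ := by
        rw [Perm.disjoint_iff_disjoint_support, hfs]; exact hdis.mono_left hVs
      refine ⟨e, f * τ, by rw [he', mul_assoc], ?_, ?_, ?_, ?_⟩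
      · rw [wt_cycle hec, hes]; omega
      · rw [wt_mul hdf, wt_cycle hfc, hfs]; omega
      · rw [hd.support_mul, hes]; exact hUs.trans Finset.subset_union_left
      · rw [hd.support_mul, hdf.support_mul, hfs]; exact Finset.union_subset_union_left hVs
  have one : ∀ M N, wt (1 : Perm α) + 2 ≤ M + N → ∃ β γ : Perm α, 1 = β * γ ∧
    wt β ≤ M ∧ wt γ ≤ N ∧ β.support ⊆ (1 : Perm α).support ∧ γ.support ⊆ (1 : Perm α).support :=
    fun M N _ => ⟨1, 1, by simp, by simp [wt_one], by simp [wt_one], by simp, by simp⟩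
  induction σ using Perm.cycle_induction_on with
  | base_one => exact one
  | base_cycles σ hσ =>
    have := step σ 1 (Perm.disjoint_one_right σ) hσ one
    simpa only [mul_one] using this
  | induction_disjoint σ τ hd hσ ih1 ih2 => exact step σ τ hd hσ ih2

theorem split_two : ∀ (k : ℕ) (σ : Perm α), k ≤ σ.cycleType.count 2 → ∃ β γ : Perm α,
    σ = β * γ ∧ β.Disjoint γ ∧ wt β = 3 * k
  | 0, σ, _ => ⟨1, σ, by simp, Perm.disjoint_one_left σ, by simp [wt_one]⟩
  | k + 1, σ, h => by
    have h2 : 2 ∈ σ.cycleType := Multiset.count_pos.1 (by omega)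
    obtain ⟨c, τ, rfl, hd, hc, hc2⟩ := Perm.mem_cycleType_iff.1 h2
    rw [hd.cycleType_mul, hc.cycleType, hc2] at h
    simp at h
    obtain ⟨β, γ, rfl, hβγ, hw⟩ := split_two k τ (by omega)
    have hdis := hd.disjoint_support
    rw [hβγ.support_mul, Finset.disjoint_union_right] at hdis
    have h1 : c.Disjoint β := by rw [Perm.disjoint_iff_disjoint_support]; exact hdis.1
    have h3 : c.Disjoint γ := by rw [Perm.disjoint_iff_disjoint_support]; exact hdis.2
    refine ⟨c * β, γ, by rw [mul_assoc], h3.mul_left hβγ, ?_⟩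
    rw [wt_mul h1, wt_cycle hc, hc2, hw]; omega

/-- Product of four cyclic permutations of size `l`. -/
def Four (σ : Perm α) (l : ℕ) : Prop :=
  ∃ β γ : Perm α, σ = β * γ ∧ Two β l l ∧ Two γ l l

theorem four_of_split {σ β γ : Perm α} {l : ℕ} (hl : 2 ≤ l) (hn : l ≤ Fintype.card α)
    (he : σ = β * γ) (hβ : wt β ≤ 2 * l) (hγ : wt γ ≤ 2 * l) (hpar : Even (wt β + wt γ)) :
    Four σ l := by
  rcases Nat.even_or_odd (wt β) with h | h
  · have h' : Even (wt γ) := (Nat.even_add.1 hpar).1 h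
    refine ⟨β, γ, he, two_of_wt β l l (by omega) ?_ (by omega) (by omega) (by omega) (by omega) hn hn,
      two_of_wt γ l l (by omega) ?_ (by omega) (by omega) (by omega) (by omega) hn hn⟩
    · exact (Even.add_self l).add h
    · exact (Even.add_self l).add h'
  · have h' : Odd (wt γ) := by
      rw [← Nat.not_even_iff_odd] at h ⊢
      exact fun h2 => h ((Nat.even_add.1 hpar).2 h2)
    obtain ⟨x, hx⟩ := h
    obtain ⟨y, hy⟩ := h'
    obtain ⟨c, d, S, T, hc, hd, hS, hT, rfl⟩ := two_of_wt β l (l - 1) (by omega)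
      ⟨l + x, by omega⟩ (by omega) (by omega) (by omega) (by omega) hn (by omega)
    obtain ⟨e, f, U, V, hee, hf, hU, hV, rfl⟩ := two_of_wt γ (l - 1) l (by omega)
      ⟨l + y, by omega⟩ (by omega) (by omega) (by omega) (by omega) (by omega) hn
    obtain ⟨d', e', T', U', hd', he', hT', hU', hde⟩ :=
      Two.raise1 ⟨d, e, T, U, hd, hee, hT, hU, rfl⟩ (by omega) (by omega) (by omega) (by omega)
    refine ⟨c * d', e' * f, ?_, ⟨c, d', S, T', hc, hd', hS, by omega, rfl⟩,
      ⟨e', f, U', V, he', hf, by omega, hV, rfl⟩⟩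
    rw [he, mul_assoc, ← mul_assoc d, hde]; simp [mul_assoc]

theorem even_wt {σ : Perm α} (h : Perm.sign σ = 1) : Even (wt σ) := by
  rw [Perm.sign_of_cycleType] at h
  rcases Nat.even_or_odd (wt σ) with h' | h'
  · exact h'
  · exfalso
    rw [show σ.cycleType.sum + Multiset.card σ.cycleType = wt σ from rfl, h'.neg_one_pow] at h
    exact absurd h (by decide)

theorem ms_bound (s : Multiset ℕ) (h : ∀ a ∈ s, 2 ≤ a) :
    2 * Multiset.card s ≤ s.sum ∧ 3 * Multiset.card s ≤ s.sum + s.count 2 := by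
  induction s using Multiset.induction_on with
  | empty => simp
  | cons a s ih =>
    have h1 := h a (by simp)
    have h2 := ih (fun b hb => h b (by simp [hb]))
    rw [Multiset.card_cons, Multiset.sum_cons, Multiset.count_cons]
    split_ifs <;> omega

theorem ms_three (s : Multiset ℕ) (h : ∀ a ∈ s, 2 ≤ a) (h3 : 3 ∉ s) :
    4 * Multiset.card s ≤ s.sum + 2 * s.count 2 := by
  induction s using Multiset.induction_on with
  | empty => simp
  | cons a s ih =>
    have h1 := h a (by simp)
    have h2 := ih (fun b hb => h b (by simp [hb])) (fun hb => h3 (by simp [hb]))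
    have h4 : a ≠ 3 := fun hb => h3 (by simp [hb])
    rw [Multiset.card_cons, Multiset.sum_cons, Multiset.count_cons]
    split_ifs <;> omega

theorem three_of_six {τ : Perm α} (hs : τ.cycleType.sum = 6) (hc : Multiset.card τ.cycleType = 2)
    (hn : 3 ≤ Fintype.card α) :
    ∃ β γ : Perm α, (∃ S, CycOn β S ∧ S.card = 3) ∧ Two γ 3 3 ∧ τ = β * γ := by
  obtain ⟨a, b, hab⟩ := Multiset.card_eq_two.1 hc
  have ha := Perm.two_le_of_mem_cycleType (σ := τ) (n := a) (by simp [hab])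
  have hb := Perm.two_le_of_mem_cycleType (σ := τ) (n := b) (by simp [hab])
  have hsum : a + b = 6 := by simpa [hab] using hs
  have h34 : 3 ∈ τ.cycleType ∨ 4 ∈ τ.cycleType := by
    rw [hab]; simp; omega
  have main : ∀ r, r ∈ τ.cycleType → ∃ y z : Perm α, CycOn y y.support ∧ CycOn z z.support ∧
      y.support.card = r ∧ z.support.card + r = 6 ∧ τ = y * z := by
    intro r hr
    obtain ⟨y, z, rfl, hd, hy, hyr⟩ := Perm.mem_cycleType_iff.1 hr
    rw [hd.cycleType_mul, hy.cycleType, hyr] at hs hc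
    simp only [Multiset.sum_add, Multiset.sum_singleton, Multiset.card_add,
      Multiset.card_singleton] at hs hc
    have hz : z.IsCycle := Perm.card_cycleType_eq_one.1 (by omega)
    refine ⟨y, z, cycOn_of_isCycle hy, cycOn_of_isCycle hz, hyr, ?_, rfl⟩
    rw [Perm.sum_cycleType] at hs; omega
  rcases h34 with h | h
  · obtain ⟨y, z, hy, hz, hyr, hzr, rfl⟩ := main 3 h
    obtain ⟨c₁, c₂, S₁, S₂, q, h1, h2, h3, h4, -, -, -, -, he⟩ := hz.cut (i := 2) (j := 2)
      (by omega) (by omega) (by omega)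
    have hn' : 3 ≤ Fintype.card α := hn
    exact ⟨y, z, ⟨_, hy, hyr⟩, Two.raise1 ⟨c₁, c₂, S₁, S₂, h1, h2, h3, h4, he⟩ (by omega) (by omega)
      (by omega) (by omega), rfl⟩
  · obtain ⟨y, z, hy, hz, hyr, hzr, rfl⟩ := main 4 h
    obtain ⟨c₁, c₂, S₁, S₂, q, h1, h2, h3, h4, -, -, -, -, he⟩ := hy.cut (i := 3) (j := 2)
      (by omega) (by omega) (by omega)
    refine ⟨c₁, c₂ * z, ⟨_, h1, h3⟩, Two.raise1 ⟨c₂, z, S₂, _, h2, hz, h4, ?_, rfl⟩ (by omega)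
      (by omega) (by omega) (by omega), by rw [he, mul_assoc]⟩
    omega

theorem four_main (m : ℕ) (hm : 1 ≤ m) (hα : Fintype.card α = 8 * m + 1) (σ : Perm α)
    (hσ : Perm.sign σ = 1) : Four σ (3 * m) := by
  have hev := even_wt hσ
  obtain ⟨hb1, hb2⟩ := ms_bound σ.cycleType (fun a ha => Perm.two_le_of_mem_cycleType ha)
  have hs := σ.sum_cycleType_le
  have hw : wt σ = σ.cycleType.sum + Multiset.card σ.cycleType := rfl
  by_cases hsm : wt σ + 2 ≤ 6 * m + 6 * m
  · obtain ⟨β, γ, he, hβ, hγ, -, -⟩ := split σ (6 * m) (6 * m) hsm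
    refine four_of_split (β := β) (γ := γ) (by omega) (by omega) he (by omega) (by omega) ?_
    have h1 : Perm.sign β * Perm.sign γ = 1 := by rw [← hσ, he, Perm.sign_mul]
    rw [Perm.sign_of_cycleType, Perm.sign_of_cycleType, ← pow_add] at h1
    rcases Nat.even_or_odd (wt β + wt γ) with h' | h'
    · exact h'
    · exfalso
      have h2 : (-1 : ℤˣ) ^ (wt β + wt γ) = 1 := h1
      rw [h'.neg_one_pow] at h2
      exact absurd h2 (by decide)
  obtain ⟨t, ht⟩ := hev
  by_cases h2 : 2 * m ≤ σ.cycleType.count 2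
  · obtain ⟨β, γ, he, hd, hβ⟩ := split_two (2 * m) σ h2
    have := wt_mul hd
    rw [← he] at this
    exact four_of_split (β := β) (γ := γ) (by omega) (by omega) he (by omega) (by omega)
      ⟨t, by omega⟩
  have hm1 : m = 1 := by omega
  subst hm1
  have h3 : 3 ∈ σ.cycleType := by
    by_contra h3
    have := ms_three σ.cycleType (fun a ha => Perm.two_le_of_mem_cycleType ha) h3
    omega
  have hsum : σ.cycleType.sum = 9 := by omega
  have hcard : Multiset.card σ.cycleType = 3 := by omega
  obtain ⟨c, τ, rfl, hd, hc, hc3⟩ := Perm.mem_cycleType_iff.1 h3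
  rw [hd.cycleType_mul, hc.cycleType, hc3] at hsum hcard
  simp only [Multiset.sum_add, Multiset.sum_singleton, Multiset.card_add,
      Multiset.card_singleton] at hsum hcard
  obtain ⟨β, γ, ⟨S, hβ, hS⟩, hγ, rfl⟩ := three_of_six (τ := τ) (by omega) (by omega) (by omega)
  exact ⟨c * β, γ, by rw [mul_assoc], ⟨c, β, _, S, cycOn_of_isCycle hc, hβ, hc3, hS, rfl⟩, hγ⟩

end Part1

theorem part1 (N m : ℕ) (hm : 1 ≤ m) (hN : N = 8 * m + 1) (σ : Perm (Fin N))
    (hσ : σ ∈ alternatingGroup (Fin N)) : IsProdOfCycles N 4 (3 * m) σ := by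
  obtain ⟨β, γ, rfl, ⟨c, d, S, T, hc, hd, hS, hT, rfl⟩, ⟨e, f, U, V, he, hf, hU, hV, rfl⟩⟩ :=
    four_main m hm (by simpa using hN) σ (Perm.mem_alternatingGroup.1 hσ)
  have key : ∀ (g : Perm (Fin N)) (W : Finset (Fin N)), CycOn g W → W.card = 3 * m →
      g.IsCycle ∧ g.support.card = 3 * m := by
    intro g W hg hW
    obtain ⟨h1, h2⟩ := hg.isCycle (by omega)
    exact ⟨h1, by rw [h2, hW]⟩
  refine ⟨![c, d, e, f], ?_, ?_⟩
  · intro i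
    fin_cases i
    · exact key c S hc hS
    · exact key d T hd hT
    · exact key e U he hU
    · exact key f V hf hV
  · simp [List.ofFn_succ, mul_assoc]

section Part2

variable {α : Type*} [Fintype α] [DecidableEq α]

/-- Functions fixed by `p`. -/
def Fx (p : Perm α) : Submodule ℚ (α → ℚ) where
  carrier := {v | ∀ i, v (p i) = v i}
  add_mem' := by intro a b ha hb i; simp [ha i, hb i]
  zero_mem' := by intro i; simp
  smul_mem' := by intro c a ha i; simp [ha i]

/-- Functions constant along the edges in `E`. -/
def Wx (E : List (α × α)) : Submodule ℚ (α → ℚ) where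
  carrier := {v | ∀ e ∈ E, v e.1 = v e.2}
  add_mem' := by intro a b ha hb i hi; simp [ha i hi, hb i hi]
  zero_mem' := by intro i; simp
  smul_mem' := by intro c a ha i hi; simp [ha i hi]

theorem mem_Fx {p : Perm α} {v : α → ℚ} : v ∈ Fx p ↔ ∀ i, v (p i) = v i := Iff.rfl

theorem mem_Wx {E : List (α × α)} {v : α → ℚ} : v ∈ Wx E ↔ ∀ e ∈ E, v e.1 = v e.2 := Iff.rfl

/-- Product of the transpositions in `E`. -/
def pr (E : List (α × α)) : Perm α := (E.map fun e => swap e.1 e.2).prod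

theorem pr_cons (e : α × α) (E : List (α × α)) : pr (e :: E) = swap e.1 e.2 * pr E := by simp [pr]

theorem pr_append (E E' : List (α × α)) : pr (E ++ E') = pr E * pr E' := by simp [pr]

theorem finrank_le (U : Submodule ℚ (α → ℚ)) : Module.finrank ℚ U ≤ Fintype.card α := by
  have := Submodule.finrank_le U
  simpa using this

theorem hyp (U U' : Submodule ℚ (α → ℚ)) (x y : α)
    (h : ∀ v ∈ U, v x = v y → v ∈ U') :
    Module.finrank ℚ U ≤ Module.finrank ℚ U' + 1 := by
  let f : (α → ℚ) →ₗ[ℚ] ℚ :=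
    (LinearMap.proj x : (α → ℚ) →ₗ[ℚ] ℚ) - (LinearMap.proj y : (α → ℚ) →ₗ[ℚ] ℚ)
  have h1 := LinearMap.finrank_range_add_finrank_ker f
  have h2 : Module.finrank ℚ (LinearMap.range f) ≤ 1 := by
    have := Submodule.finrank_le (LinearMap.range f)
    simpa using this
  have h3 := Submodule.finrank_sup_add_finrank_inf_eq U (LinearMap.ker f)
  have h4 := finrank_le (U ⊔ LinearMap.ker f)
  have h5 : U ⊓ LinearMap.ker f ≤ U' := by
    rintro v ⟨hv, hk⟩
    refine h v hv ?_
    have : v x - v y = 0 := hk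
    linarith
  have h6 := Submodule.finrank_mono h5
  rw [Module.finrank_pi] at h1
  omega

theorem Wx_le_Fx (E : List (α × α)) : Wx E ≤ Fx (pr E) := by
  induction E with
  | nil => intro v _ i; simp [pr]
  | cons e E ih =>
    intro v hv i
    have h1 : v ∈ Fx (pr E) := ih (fun e' he' => hv e' (by simp [he']))
    have h2 := hv e (by simp)
    rw [pr_cons, Perm.mul_apply, ← h1 i]
    generalize pr E i = j
    rw [swap_apply_def]
    split_ifs with h3 h4
    · rw [h3, h2]
    · rw [h4, h2]
    · rfl

theorem Wx_lower (E : List (α × α)) : Fintype.card α ≤ Module.finrank ℚ (Wx E) + E.length := by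
  induction E with
  | nil =>
    have : Wx ([] : List (α × α)) = ⊤ := by
      ext v; simp [mem_Wx]
    rw [this, finrank_top]; simp
  | cons e E ih =>
    have := hyp (Wx E) (Wx (e :: E)) e.1 e.2 (by
      intro v hv he e' he'
      rcases List.mem_cons.1 he' with rfl | h
      · exact he
      · exact hv e' h)
    simp only [List.length_cons]
    omega

theorem genus (E : List (α × α)) : Module.finrank ℚ (Fx (pr E)) + Fintype.card α ≤
    E.length + 2 * Module.finrank ℚ (Wx E) := by
  induction E with
  | nil =>
    have := finrank_le (Fx (pr ([] : List (α × α))))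
    have := Wx_lower ([] : List (α × α))
    simp only [List.length_nil] at *
    omega
  | cons e E ih =>
    obtain ⟨x, y⟩ := e
    have hsw : ∀ v : α → ℚ, v x = v y → ∀ j, v (swap x y j) = v j := by
      intro v h j
      rw [swap_apply_def]
      split_ifs with h3 h4
      · rw [h3, h]
      · rw [h4, h]
      · rfl
    by_cases hu : ∀ u ∈ Wx E, u x = u y
    · have h1 : Module.finrank ℚ (Wx E) ≤ Module.finrank ℚ (Wx ((x, y) :: E)) := by
        apply Submodule.finrank_mono
        intro v hv e' he'
        rcases List.mem_cons.1 he' with rfl | h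
        · exact hu v hv
        · exact hv e' h
      have h2 := hyp (Fx (pr ((x, y) :: E))) (Fx (pr E)) x y (by
        intro v hv he i
        have := hv i
        rw [pr_cons, Perm.mul_apply] at this
        rw [← this]
        exact (hsw v he _).symm)
      simp only [List.length_cons]
      omega
    · push Not at hu
      obtain ⟨u, huW, hne⟩ := hu
      have hk := hyp (Wx E) (Wx ((x, y) :: E)) x y (by
        intro v hv he e' he'
        rcases List.mem_cons.1 he' with rfl | h
        · exact he
        · exact hv e' h)
      have huF : u ∈ Fx (pr E) := Wx_le_Fx E huW
      have hxy : x ≠ y := fun h => hne (by rw [h])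
      have heq : ∀ v ∈ Fx (pr ((x, y) :: E)), v x = v y := by
        intro v hv
        have h1 : ∑ i, u i * v i = ∑ j, u j * v (swap x y j) := by
          rw [← Equiv.sum_comp (pr E) (fun j => u j * v (swap x y j))]
          refine Finset.sum_congr rfl fun i _ => ?_
          have := hv i
          rw [pr_cons, Perm.mul_apply] at this
          simp only at this
          rw [this, huF i]
        have h2 : ∑ j, u j * (v j - v (swap x y j)) = 0 := by
          simp only [mul_sub, Finset.sum_sub_distrib]
          rw [h1, sub_self]
        rw [← Finset.sum_subset (Finset.subset_univ {x, y})] at h2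
        · rw [Finset.sum_pair hxy, swap_apply_left, swap_apply_right] at h2
          have h3 : (u x - u y) * (v x - v y) = 0 := by linear_combination h2
          rcases mul_eq_zero.1 h3 with h | h
          · exact absurd (sub_eq_zero.1 h) hne
          · exact sub_eq_zero.1 h
        · intro j _ hj
          simp at hj
          rw [swap_apply_of_ne_of_ne hj.1 hj.2]; simp
      have hlt : Fx (pr ((x, y) :: E)) < Fx (pr E) := by
        refine lt_of_le_of_ne ?_ ?_
        · intro v hv i
          have := hv i
          rw [pr_cons, Perm.mul_apply] at this
          rw [← this]
          exact (hsw v (heq v hv) _).symm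
        · intro h
          rw [← h] at huF
          exact hne (heq u huF)
      have := Submodule.finrank_lt_finrank_of_lt hlt
      simp only [List.length_cons]
      omega

theorem cyc_edges {c : Perm α} (hc : c.IsCycle) :
    ∃ E : List (α × α), pr E = c ∧ E.length + 1 = c.support.card := by
  obtain ⟨L, hL, hS, rfl⟩ := cycOn_of_isCycle hc
  refine ⟨L.zip L.tail, ?_, ?_⟩
  · simp [pr, List.formPerm, List.zip, List.map_zipWith]
  · have h2 := hc.two_le_card_support
    rw [← hS, List.toFinset_card_of_nodup hL] at *
    simp; omega

theorem all_edges (σ : Perm α) :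
    ∃ E : List (α × α), pr E = σ ∧ E.length + Multiset.card σ.cycleType = σ.cycleType.sum := by
  induction σ using Perm.cycle_induction_on with
  | base_one => exact ⟨[], by simp [pr], by simp⟩
  | base_cycles σ hσ =>
    obtain ⟨E, h1, h2⟩ := cyc_edges hσ
    exact ⟨E, h1, by simp [hσ.cycleType, h2]⟩
  | induction_disjoint σ τ hd hσ ih1 ih2 =>
    obtain ⟨E, h1, h2⟩ := ih1
    obtain ⟨F, h3, h4⟩ := ih2
    refine ⟨E ++ F, by rw [pr_append, h1, h3], ?_⟩
    rw [hd.cycleType_mul]; simp; omega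

theorem const_on {c : Perm α} (hc : c.IsCycle) {v : α → ℚ} (hv : v ∈ Fx c) {x y : α}
    (hx : x ∈ c.support) (hy : y ∈ c.support) : v x = v y := by
  obtain ⟨k, hk⟩ := hc.exists_pow_eq (Perm.mem_support.1 hx) (Perm.mem_support.1 hy)
  have : ∀ k : ℕ, v ((c ^ k) x) = v x := by
    intro k
    induction k with
    | zero => simp
    | succ k ih => rw [pow_succ', Perm.mul_apply, hv, ih]
  rw [← hk, this]

theorem not_isolated {σ : Perm α} (c : Fin 4 → Perm α) (hσ : σ = c 0 * c 1 * c 2 * c 3)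
    (h20 : σ ^ 20 = 1) {l : ℕ} (hl3 : 3 ∣ l) (hc : ∀ i, (c i).IsCycle ∧ (c i).support.card = l)
    (i : Fin 4) : ∃ j, j ≠ i ∧ ¬ _root_.Disjoint (c i).support (c j).support := by
  by_contra hcon
  push Not at hcon
  have hfix : ∀ j, j ≠ i → ∀ x ∈ (c i).support, c j x = x := by
    intro j hj x hx
    exact Perm.notMem_support.1 (Finset.disjoint_left.1 (hcon j hj) hx)
  have hap : ∀ x ∈ (c i).support, σ x = c i x := by
    intro x hx
    have hx' : c i x ∈ (c i).support := Perm.apply_mem_support.2 hx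
    rw [hσ]
    simp only [Perm.mul_apply]
    fin_cases i
    · simp [hfix 1 (by decide) x hx, hfix 2 (by decide) x hx, hfix 3 (by decide) x hx]
    · have := hfix 0 (by decide) _ hx'
      simp [hfix 2 (by decide) x hx, hfix 3 (by decide) x hx] at *
      exact this
    · have h0 := hfix 0 (by decide) _ hx'
      have h1 := hfix 1 (by decide) _ hx'
      have h3 := hfix 3 (by decide) x hx
      simp at h0 h1
      simp [h3, h0, h1]
    · have h0 := hfix 0 (by decide) _ hx'
      have h1 := hfix 1 (by decide) _ hx'
      have h2 := hfix 2 (by decide) _ hx'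
      simp at h0 h1 h2
      simp [h0, h1, h2]
  have hpow : ∀ k : ℕ, ∀ x ∈ (c i).support, (σ ^ k) x = (c i ^ k) x := by
    intro k x hx
    induction k with
    | zero => simp
    | succ k ih =>
      rw [pow_succ', pow_succ', Perm.mul_apply, Perm.mul_apply, ih, hap]
      exact Perm.pow_apply_mem_support.2 hx
  have h1 : c i ^ 20 = 1 := by
    ext x
    by_cases hx : x ∈ (c i).support
    · rw [← hpow 20 x hx, h20]
    · rw [Perm.pow_apply_eq_self_of_apply_eq_self (Perm.notMem_support.1 hx)]; simp
  have h2 := orderOf_dvd_of_pow_eq_one h1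
  rw [(hc i).1.orderOf, (hc i).2] at h2
  have := hl3.trans h2
  omega

theorem not_four {σ : Perm α} (c : Fin 4 → Perm α) (hσ : σ = c 0 * c 1 * c 2 * c 3)
    (h20 : σ ^ 20 = 1) {l : ℕ} (hl3 : 3 ∣ l) (hc : ∀ i, (c i).IsCycle ∧ (c i).support.card = l)
    (hfp : ∀ x, σ x ≠ x) : wt σ ≤ 4 * l := by
  have hadj := not_isolated c hσ h20 hl3 hc
  choose h hne hnd using hadj
  choose E hE hEl using fun i => cyc_edges (hc i).1
  have hg := genus (E 0 ++ E 1 ++ E 2 ++ E 3)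
  have hpr : pr (E 0 ++ E 1 ++ E 2 ++ E 3) = σ := by
    simp only [pr_append, hE, hσ]
  obtain ⟨F, hF, hFl⟩ := all_edges σ
  have h1 := Wx_lower F
  have h2 := Submodule.finrank_mono (Wx_le_Fx F)
  rw [hF] at h2
  rw [hpr] at hg
  have hsum : σ.cycleType.sum = Fintype.card α := by
    rw [Perm.sum_cycleType, show σ.support = Finset.univ from ?_, Finset.card_univ]
    ext x; simp [hfp x]
  -- dimension of the common fixed space
  have hK : Module.finrank ℚ (Wx (E 0 ++ E 1 ++ E 2 ++ E 3)) ≤ 2 := by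
    have hFx : ∀ v ∈ Wx (E 0 ++ E 1 ++ E 2 ++ E 3), ∀ i, v ∈ Fx (c i) := by
      intro v hv i
      rw [← hE i]
      apply Wx_le_Fx
      intro e he
      apply hv
      fin_cases i <;> simp at he ⊢ <;> tauto
    have hpt : ∀ i, ∃ s, s ∈ (c i).support := fun i => by
      have := (hc i).1.two_le_card_support
      exact Finset.card_pos.1 (by omega)
    choose s hs using hpt
    have hcov : ∀ x, ∃ i, x ∈ (c i).support := by
      intro x
      by_contra hcon
      push Not at hcon
      apply hfp x
      rw [hσ]
      simp only [Perm.mul_apply, Perm.notMem_support.1 (hcon _)]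
    have hhs : ∀ v ∈ Wx (E 0 ++ E 1 ++ E 2 ++ E 3), ∀ i, v (s i) = v (s (h i)) := by
      intro v hv i
      obtain ⟨x, hx, hx'⟩ := Finset.not_disjoint_iff.1 (hnd i)
      rw [const_on (hc i).1 (hFx v hv i) (hs i) hx,
        const_on (hc _).1 (hFx v hv _) (hs _) hx']
    obtain ⟨b, hb⟩ : ∃ b : Fin 4, ∀ k : Fin 4, k ≠ 0 → k ≠ h 0 → k ≠ b →
        ∀ j, j ≠ k → j = 0 ∨ j = h 0 ∨ j = b := by
      have h00 := hne 0
      generalize h 0 = t at *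
      revert t; decide
    let f : (α → ℚ) →ₗ[ℚ] ℚ × ℚ :=
      (LinearMap.proj (s 0) : (α → ℚ) →ₗ[ℚ] ℚ).prod (LinearMap.proj (s b) : (α → ℚ) →ₗ[ℚ] ℚ)
    have hinj : Function.Injective (f.domRestrict (Wx (E 0 ++ E 1 ++ E 2 ++ E 3))) := by
      rw [injective_iff_map_eq_zero]
      rintro ⟨v, hv⟩ hv0
      have hv0' : (v (s 0), v (s b)) = (0, 0) := hv0
      have e1 : v (s 0) = 0 := congrArg Prod.fst hv0'
      have e2 : v (s b) = 0 := congrArg Prod.snd hv0'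
      have e3 : v (s (h 0)) = 0 := by rw [← hhs v hv 0, e1]
      have e4 : ∀ k, v (s k) = 0 := by
        intro k
        by_cases k0 : k = 0
        · rw [k0, e1]
        by_cases k1 : k = h 0
        · rw [k1, e3]
        by_cases k2 : k = b
        · rw [k2, e2]
        rw [hhs v hv k]
        rcases hb k k0 k1 k2 (h k) (hne k) with h' | h' | h' <;> rw [h'] <;> assumption
      ext x
      obtain ⟨i, hi⟩ := hcov x
      have := const_on (hc i).1 (hFx v hv i) hi (hs i)
      simp only [this, e4]
      rfl
    have := LinearMap.finrank_le_finrank_of_injective hinj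
    simpa using this
  have hl0 := hEl 0
  have hl1 := hEl 1
  have hl2 := hEl 2
  have hl3' := hEl 3
  rw [(hc _).2] at hl0 hl1 hl2 hl3'
  simp only [List.length_append] at hg
  rw [wt]
  omega

theorem exists_type (m n : ℕ) (hm : 1 ≤ m) (hn : 8 * m + 1 < n) :
    ∃ s : Multiset ℕ, s.sum = n ∧ (∀ a ∈ s, 2 ≤ a ∧ a ∣ 20) ∧ Even (n + Multiset.card s) ∧
      12 * m < n + Multiset.card s := by
  have hd : ∀ k : ℕ, ∀ a ∈ Multiset.replicate k 2, 2 ≤ a ∧ a ∣ 20 := by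
    intro k a ha
    rw [Multiset.eq_of_mem_replicate ha]
    norm_num
  rcases Nat.even_or_odd' n with ⟨k, rfl | rfl⟩ <;> rcases Nat.even_or_odd' k with ⟨j, rfl | rfl⟩
  · refine ⟨Multiset.replicate (2 * j) 2, by simp; omega, hd _, ?_, ?_⟩
    · exact ⟨3 * j, by simp; omega⟩
    · simp; omega
  · refine ⟨4 ::ₘ Multiset.replicate (2 * j - 1) 2, by simp; omega, ?_, ?_, ?_⟩
    · intro a ha
      rcases Multiset.mem_cons.1 ha with rfl | h
      · norm_num
      · exact hd _ a h
    · exact ⟨3 * j + 1, by simp; omega⟩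
    · simp; omega
  · refine ⟨5 ::ₘ Multiset.replicate (2 * j - 2) 2, by simp; omega, ?_, ?_, ?_⟩
    · intro a ha
      rcases Multiset.mem_cons.1 ha with rfl | h
      · norm_num
      · exact hd _ a h
    · exact ⟨3 * j, by simp; omega⟩
    · simp; omega
  · refine ⟨5 ::ₘ 4 ::ₘ Multiset.replicate (2 * j - 3) 2, by simp; omega, ?_, ?_, ?_⟩
    · intro a ha
      rcases Multiset.mem_cons.1 ha with rfl | h
      · norm_num
      · rcases Multiset.mem_cons.1 h with rfl | h
        · norm_num
        · exact hd _ a h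
    · exact ⟨3 * j + 1, by simp; omega⟩
    · simp; omega

end Part2

theorem part2 (m n : ℕ) (hm : 1 ≤ m) (hn : 8 * m + 1 < n) :
    ∃ σ ∈ alternatingGroup (Fin n), ¬ IsProdOfCycles n 4 (3 * m) σ := by
  obtain ⟨s, hs, hs2, hev, hgt⟩ := exists_type m n hm hn
  obtain ⟨σ, hσ⟩ := (Perm.exists_with_cycleType_iff (Fin n) (m := s)).2
    ⟨by simp [hs], fun a ha => (hs2 a ha).1⟩
  refine ⟨σ, ?_, ?_⟩
  · rw [Perm.mem_alternatingGroup, Perm.sign_of_cycleType, hσ, hs, hev.neg_one_pow]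
  · rintro ⟨c, hc, he⟩
    have h20 : σ ^ 20 = 1 := by
      apply orderOf_dvd_iff_pow_eq_one.1
      rw [← Perm.lcm_cycleType, hσ]
      exact Multiset.lcm_dvd.2 fun a ha => (hs2 a ha).2
    have hfp : ∀ x, σ x ≠ x := by
      have h1 := Perm.sum_cycleType σ
      rw [hσ, hs] at h1
      have h2 : σ.support = Finset.univ := by
        rw [← Finset.card_eq_iff_eq_univ, ← h1]; simp
      intro x
      rw [← Perm.mem_support, h2]; simp
    have := not_four c (by rw [he]; simp [List.ofFn_succ, mul_assoc]) h20 (dvd_mul_right 3 m) hc hfp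
    rw [wt, hσ, hs] at this
    omega

end FourCycles

theorem n_4_l_eq (l : ℕ) (hl : 2 < l) (hl3 : 3 ∣ l) :
    (∀ σ ∈ alternatingGroup (Fin (8 * l / 3 + 1)),
      IsProdOfCycles (8 * l / 3 + 1) 4 l σ) ∧
    (∀ n : ℕ, 8 * l / 3 + 1 < n →
      ∃ σ ∈ alternatingGroup (Fin n), ¬ IsProdOfCycles n 4 l σ) := by
  obtain ⟨m, rfl⟩ := hl3
  refine ⟨fun σ hσ => FourCycles.part1 _ m (by omega) (by omega) σ hσ, fun n hn =>
    FourCycles.part2 m n (by omega) (by omega)⟩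
end

section
/- Let k ≥ 2 and let l be odd with 3 dividing l and l ≥ 9. Then (2/3)kl ≤ n(k,l) ≤ (2/3)kl + 1; that is, every element of A_{2kl/3} is a product of k many l-cycles of S_{2kl/3}, and for every n > (2kl/3)+1 some element of A_n is not a product of k many l-cycles of S_n. Furthermore, if k is odd then n(k,l) = (2/3)kl; that is, additionally some element of A_{(2kl/3)+1} is not a product of k many l-cycles of S_{(2kl/3)+1}. -/
open Equiv

namespace NKL
set_option linter.unusedSectionVars false
variable {α : Type*} [Fintype α] [DecidableEq α]

lemma merge_label (f : α → ℕ) (a b : α) : ∃ f' : α → ℕ,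
    (Finset.univ.image f).card ≤ (Finset.univ.image f').card + 1 ∧ f' a = f' b ∧
    ∀ x y, f x = f y → f' x = f' y := by
  refine ⟨fun x => if f x = f b then f a else f x, ?_, ?_, ?_⟩
  · have : Finset.univ.image f ⊆ insert (f b)
        (Finset.univ.image (fun x => if f x = f b then f a else f x)) := by
      intro v hv
      obtain ⟨x, -, rfl⟩ := Finset.mem_image.1 hv
      by_cases h : f x = f b
      · simp [h]
      · refine Finset.mem_insert_of_mem (Finset.mem_image.2 ⟨x, Finset.mem_univ _, ?_⟩)
        simp [h]
    exact (Finset.card_le_card this).trans (Finset.card_insert_le _ _)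
  · simp
  · intro x y h
    simp [h]

/-- label invariance -/
lemma label_sameCycle (σ : Perm α) (h : α → ℕ) (hh : ∀ x, h (σ x) = h x) {x y : α}
    (hs : σ.SameCycle x y) : h x = h y := by
  obtain ⟨n, -, rfl⟩ := hs.exists_pow_eq'
  clear hs
  induction n with
  | zero => simp
  | succ n ih => rw [pow_succ', Perm.mul_apply, hh, ih]

lemma sameCycle_swap_mul (σ : Perm α) {a b : α} (hs : ¬ σ.SameCycle a b) :
    (swap a b * σ).SameCycle b a := by
  have hab : a ≠ b := by rintro rfl; exact hs (Perm.SameCycle.refl _ _)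
  -- minimal positive k with σ^k b = b
  have hex : ∃ k, 0 < k ∧ (σ ^ k) b = b :=
    ⟨orderOf σ, orderOf_pos σ, by rw [pow_orderOf_eq_one]; rfl⟩
  classical
  obtain ⟨hk, hkb⟩ := Nat.find_spec hex
  have hmin : ∀ j, j < Nat.find hex → 0 < j → (σ ^ j) b ≠ b := fun j hj h0 h =>
    Nat.find_min hex hj ⟨h0, h⟩
  generalize Nat.find hex = k at *
  obtain ⟨k, rfl⟩ : ∃ m, k = m + 1 := ⟨k - 1, by omega⟩
  have hna : ∀ j, (σ ^ j) b ≠ a := fun j hj => hs (Perm.SameCycle.symm ⟨j, by simpa using hj⟩)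
  have key : ∀ j, j ≤ k → ((swap a b * σ) ^ j) b = (σ ^ j) b := by
    intro j
    induction j with
    | zero => simp
    | succ j ih =>
      intro hj
      rw [pow_succ', Perm.mul_apply, ih (by omega), Perm.mul_apply, ← Perm.mul_apply σ,
        ← pow_succ']
      exact swap_apply_of_ne_of_ne (hna _) (hmin _ (by omega) (by omega))
  refine ⟨((k + 1 : ℕ) : ℤ), ?_⟩
  rw [zpow_natCast, pow_succ', Perm.mul_apply, key k le_rfl, Perm.mul_apply, ← Perm.mul_apply σ,
        ← pow_succ', hkb, swap_apply_right]

def UB (σ : Perm α) (f : α → ℕ) (T : ℕ) : Prop :=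
  (∀ x, f (σ x) = f x) ∧ ∀ h : α → ℕ, (∀ x, h (σ x) = h x) →
    Fintype.card α + (Finset.univ.image h).card ≤ T + 2 * (Finset.univ.image f).card

lemma UB_swap {σ : Perm α} {f : α → ℕ} {T : ℕ} (hU : UB σ f T) (a b : α) (hab : a ≠ b) :
    ∃ f', UB (swap a b * σ) f' (T + 1) ∧ f' a = f' b ∧ ∀ x y, f x = f y → f' x = f' y := by
  have swinv : ∀ g : α → ℕ, g a = g b → ∀ x, g (swap a b x) = g x := by
    intro g hg x
    by_cases h1 : x = a
    · subst h1; simp [hg]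
    by_cases h2 : x = b
    · subst h2; simp [hg]
    rw [swap_apply_of_ne_of_ne h1 h2]
  by_cases hf : f a = f b
  · refine ⟨f, ⟨fun x => ?_, fun h hh => ?_⟩, hf, fun _ _ h => h⟩
    · rw [Perm.mul_apply, swinv f hf, hU.1]
    · obtain ⟨g, g1, g2, g3⟩ := merge_label h a b
      have := hU.2 g (fun x => by
        have := g3 _ _ (hh x)
        rw [Perm.mul_apply, swinv g g2] at this
        exact this)
      omega
  · obtain ⟨f', f1, f2, f3⟩ := merge_label f a b
    refine ⟨f', ⟨fun x => ?_, fun h hh => ?_⟩, f2, f3⟩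
    · rw [Perm.mul_apply, swinv f' f2]; exact f3 _ _ (hU.1 x)
    · have hs : ¬ σ.SameCycle a b := fun hs => hf (label_sameCycle σ f hU.1 hs)
      have hba : h b = h a := label_sameCycle _ h hh (sameCycle_swap_mul σ hs)
      have hinv : ∀ x, h (σ x) = h x := fun x => by
        have := hh x
        rw [Perm.mul_apply, swinv h hba.symm] at this
        exact this
      classical
      obtain ⟨w, hw⟩ := Infinite.exists_notMem_finset (Finset.univ.image h)
      let g : α → ℕ := fun x => if σ.SameCycle a x then w else h x
      have hg := hU.2 g (fun x => by
        simp only [g, Perm.sameCycle_apply_right, hinv])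
      have : insert w (Finset.univ.image h) ⊆ Finset.univ.image g := by
        intro v hv
        rcases Finset.mem_insert.1 hv with rfl | hv
        · exact Finset.mem_image.2 ⟨a, Finset.mem_univ _, by simp [g, Perm.SameCycle.refl]⟩
        · obtain ⟨x, -, rfl⟩ := Finset.mem_image.1 hv
          by_cases hx : σ.SameCycle a x
          · refine Finset.mem_image.2 ⟨b, Finset.mem_univ _, ?_⟩
            simp only [g, hs, if_false]
            rw [hba]; exact label_sameCycle σ h hinv hx
          · exact Finset.mem_image.2 ⟨x, Finset.mem_univ _, by simp [g, hx]⟩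
      have := Finset.card_le_card this
      rw [Finset.card_insert_of_notMem hw] at this
      omega

lemma UB_formPerm {σ : Perm α} {f : α → ℕ} {T : ℕ} (hU : UB σ f T) (L : List α)
    (hL : L.Nodup) :
    ∃ f', UB (L.formPerm * σ) f' (T + (L.length - 1)) ∧ (∀ x ∈ L, ∀ y ∈ L, f' x = f' y) ∧
      ∀ x y, f x = f y → f' x = f' y := by
  induction L with
  | nil => exact ⟨f, by simpa using hU, by simp, fun _ _ h => h⟩
  | cons x L ih =>
    cases L with
    | nil => exact ⟨f, by simpa using hU, by simp, fun _ _ h => h⟩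
    | cons y L =>
      obtain ⟨f1, h1, h2, h3⟩ := ih hL.of_cons
      have hxy : x ≠ y := by
        rintro rfl; simp at hL
      obtain ⟨f2, k1, k2, k3⟩ := UB_swap h1 x y hxy
      refine ⟨f2, ?_, ?_, fun a b h => k3 _ _ (h3 _ _ h)⟩
      · rw [List.formPerm_cons_cons, mul_assoc]
        simpa [add_assoc] using k1
      · have : ∀ z ∈ x :: y :: L, f2 z = f2 y := by
          intro z hz
          rcases List.mem_cons.1 hz with rfl | hz
          · exact k2
          · exact k3 _ _ (h2 _ hz _ (by simp))
        intro u hu v hv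
        rw [this u hu, this v hv]

lemma exists_list (c : Perm α) (hc : c.IsCycle) : ∃ L : List α, L.Nodup ∧ L.formPerm = c ∧
    L.length = c.support.card ∧ ∀ x, x ∈ L ↔ x ∈ c.support := by
  obtain ⟨x, hx, -⟩ := id hc
  refine ⟨c.toList x, Perm.nodup_toList _ _, ?_, ?_, ?_⟩
  · rw [Perm.formPerm_toList, hc.cycleOf_eq hx]
  · rw [Perm.length_toList, hc.cycleOf_eq hx]
  · intro y
    rw [Perm.mem_toList_iff]
    constructor
    · rintro ⟨h, -⟩
      exact Perm.mem_support.2 fun hy => (hx) ((h.apply_eq_self_iff).2 hy)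
    · intro hy
      exact ⟨hc.sameCycle hx (Perm.mem_support.1 hy), by simpa using hx⟩

lemma UB_list {l : ℕ} (L : List (Perm α)) (hL : ∀ c ∈ L, c.IsCycle ∧ c.support.card = l) :
    ∃ f : α → ℕ, UB L.prod f (L.length * (l - 1)) ∧
      ∀ c ∈ L, ∀ x ∈ c.support, ∀ y ∈ c.support, f x = f y := by
  induction L with
  | nil =>
    obtain ⟨e⟩ := Fintype.truncEquivFin α |>.nonempty
    refine ⟨fun x => e x, ⟨by simp, fun h _ => ?_⟩, by simp⟩
    have : (Finset.univ.image (fun x => (e x : ℕ))).card = Fintype.card α := by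
      rw [Finset.card_image_of_injective _ (fun x y h => e.injective (Fin.ext h))]; rfl
    have h2 : (Finset.univ.image h).card ≤ Fintype.card α := Finset.card_image_le
    omega
  | cons c L ih =>
    obtain ⟨f, h1, h2⟩ := ih (fun d hd => hL d (by simp [hd]))
    obtain ⟨hc, hcl⟩ := hL c (by simp)
    obtain ⟨M, m1, m2, m3, m4⟩ := exists_list c hc
    obtain ⟨f', k1, k2, k3⟩ := UB_formPerm h1 M m1
    refine ⟨f', ?_, ?_⟩
    · rw [List.prod_cons, List.length_cons, ← m2, add_mul, one_mul]
      rw [m3, hcl] at k1; exact k1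
    · intro d hd x hx y hy
      rcases List.mem_cons.1 hd with rfl | hd
      · exact k2 _ ((m4 _).2 hx) _ ((m4 _).2 hy)
      · exact k3 _ _ (h2 d hd x hx y hy)

/-- number of members of the list moving a point of class `v` -/
def Moves (f : α → ℕ) (v : ℕ) (c : Perm α) : Prop := ∃ x, f x = v ∧ c x ≠ x

open Classical in
lemma count_zero (f : α → ℕ) (v : ℕ) (L : List (Perm α))
    (h : L.countP (fun c => Moves f v c) = 0) : ∀ x, f x = v → L.prod x = x := by
  induction L with
  | nil => simp
  | cons c L ih =>
    intro x hx
    rw [List.countP_eq_zero] at h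
    have hc : ¬ Moves f v c := by simpa using h c (by simp)
    rw [List.prod_cons, Perm.mul_apply, ih (List.countP_eq_zero.2 fun d hd => h d (by simp [hd])) x hx]
    by_contra hne
    exact hc ⟨x, hx, hne⟩

open Classical in
lemma count_one (f : α → ℕ) (v : ℕ) (L : List (Perm α))
    (hinv : ∀ c ∈ L, ∀ x, f (c x) = f x)
    (h : L.countP (fun c => Moves f v c) = 1) :
    ∃ c ∈ L, Moves f v c ∧ ∀ x, f x = v → L.prod x = c x := by
  induction L with
  | nil => simp at h
  | cons c L ih =>
    by_cases hc : Moves f v c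
    · rw [List.countP_cons_of_pos (by simpa using hc)] at h
      refine ⟨c, by simp, hc, fun x hx => ?_⟩
      rw [List.prod_cons, Perm.mul_apply, count_zero f v L (by omega) x hx]
    · rw [List.countP_cons_of_neg (by simpa using hc)] at h
      obtain ⟨d, hd, hm, hp⟩ := ih (fun d hd => hinv d (by simp [hd])) h
      refine ⟨d, by simp [hd], hm, fun x hx => ?_⟩
      rw [List.prod_cons, Perm.mul_apply, hp x hx]
      by_contra hne
      exact hc ⟨d x, by rw [hinv d (by simp [hd]), hx], hne⟩

open Classical in
lemma sum_count (f : α → ℕ) (I : Finset ℕ) (L : List (Perm α))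
    (hconst : ∀ c ∈ L, ∀ x ∈ c.support, ∀ y ∈ c.support, f x = f y) :
    ∑ v ∈ I, L.countP (fun c => Moves f v c) ≤ L.length := by
  induction L with
  | nil => simp
  | cons c L ih =>
    have := ih (fun d hd => hconst d (by simp [hd]))
    simp only [List.countP_cons, Finset.sum_add_distrib, List.length_cons]
    refine Nat.add_le_add this ?_
    rw [Finset.sum_ite, Finset.sum_const_zero, add_zero, Finset.sum_const, smul_eq_mul, mul_one,
      Finset.card_le_one]
    intro u hu v hv
    simp only [decide_eq_true_eq, Finset.mem_filter] at hu hv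
    obtain ⟨-, x, rfl, hx⟩ := hu
    obtain ⟨-, y, rfl, hy⟩ := hv
    exact hconst c (by simp) x (Perm.mem_support.2 hx) y (Perm.mem_support.2 hy)

lemma upper_list {l : ℕ} (hl : 9 ≤ l) (hlo : Odd l) (L : List (Perm α))
    (hL : ∀ c ∈ L, c.IsCycle ∧ c.support.card = l) (hfix : ∀ x, L.prod x ≠ x)
    (hord : L.prod ^ 20 = 1 ∨ L.prod ^ 12 = 1) :
    ∃ t, Fintype.card α + L.prod.cycleType.card ≤ L.length * (l - 1) + 2 * t ∧
      2 * t ≤ L.length := by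
  classical
  obtain ⟨f, hU, hconst⟩ := UB_list L hL
  refine ⟨(Finset.univ.image f).card, ?_, ?_⟩
  · obtain ⟨e⟩ := Fintype.truncEquivFin (Perm α) |>.nonempty
    have := hU.2 (fun x => (e (L.prod.cycleOf x) : ℕ)) (fun x => by
      have : L.prod.cycleOf (L.prod x) = L.prod.cycleOf x :=
        (Perm.SameCycle.cycleOf_eq (Perm.sameCycle_apply_left.2 (Perm.SameCycle.refl _ _)))
      rw [this])
    have h2 : L.prod.cycleType.card ≤
        (Finset.univ.image (fun x => (e (L.prod.cycleOf x) : ℕ))).card := by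
      rw [Perm.cycleType_def, Multiset.card_map]
      change L.prod.cycleFactorsFinset.card ≤ _
      rw [← Finset.card_image_of_injective (f := fun g => (e g : ℕ)) L.prod.cycleFactorsFinset
        (fun x y h => e.injective (Fin.ext h))]
      apply Finset.card_le_card
      intro v hv
      obtain ⟨g, hg, rfl⟩ := Finset.mem_image.1 hv
      obtain ⟨x, hx⟩ := (Perm.mem_cycleFactorsFinset_iff.1 hg).1.nonempty_support
      refine Finset.mem_image.2 ⟨x, Finset.mem_univ _, ?_⟩
      rw [Perm.cycle_is_cycleOf hx hg]
    omega
  · have hinv : ∀ c ∈ L, ∀ x, f (c x) = f x := by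
      intro c hc x
      by_cases hx : x ∈ c.support
      · exact hconst c hc _ (Perm.apply_mem_support.2 hx) _ hx
      · rw [Perm.notMem_support.1 hx]
    have h2 : ∀ v ∈ Finset.univ.image f, 2 ≤ L.countP (fun c => Moves f v c) := by
      intro v hv
      obtain ⟨x, -, hx⟩ := Finset.mem_image.1 hv
      by_contra hlt
      have : L.countP (fun c => Moves f v c) = 0 ∨ L.countP (fun c => Moves f v c) = 1 := by omega
      rcases this with h0 | h1
      · exact hfix x (count_zero f v L h0 x hx)
      · obtain ⟨c, hc, ⟨y, hy, hcy⟩, hp⟩ := count_one f v L hinv h1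
        have hpow : ∀ j, (L.prod ^ j) y = (c ^ j) y := by
          have hcl : ∀ j, f ((c ^ j) y) = v := by
            intro j
            induction j with
            | zero => simpa using hy
            | succ j ih => rw [pow_succ', Perm.mul_apply, hinv c hc, ih]
          intro j
          induction j with
          | zero => simp
          | succ j ih => rw [pow_succ', pow_succ', Perm.mul_apply, Perm.mul_apply, ih, hp _ (hcl j)]
        have hdiv : ∀ j, L.prod ^ j = 1 → l ∣ j := by
          intro j hj
          have h1 : (c ^ j) y = y := by rw [← hpow, hj]; rfl
          have h2 : c ^ j = 1 := (hL c hc).1.pow_eq_one_iff.2 ⟨y, hcy, h1⟩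
          rw [← (hL c hc).2, ← (hL c hc).1.orderOf]
          exact orderOf_dvd_of_pow_eq_one h2
        rcases hord with h | h
        · have h := hdiv _ h
          have := Nat.le_of_dvd (by norm_num) h
          interval_cases l <;> revert h hlo <;> decide
        · have h := hdiv _ h
          have := Nat.le_of_dvd (by norm_num) h
          interval_cases l <;> revert h hlo <;> decide
    have h3 := sum_count f (Finset.univ.image f) L hconst
    have h4 := Finset.card_nsmul_le_sum _ _ 2 h2
    simp only [smul_eq_mul] at h4
    omega

lemma exists_bad (n : ℕ) (hn : 9 ≤ n) : ∃ σ : Perm (Fin n), σ ∈ alternatingGroup (Fin n) ∧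
    (∀ x, σ x ≠ x) ∧ (σ ^ 20 = 1 ∨ σ ^ 12 = 1) ∧ n ≤ 2 * σ.cycleType.card + 3 := by
  have main : ∀ m : Multiset ℕ, m.sum = n → (∀ a ∈ m, 2 ≤ a) → Even (m.sum + m.card) →
      ((∀ a ∈ m, a ∣ 20) ∨ (∀ a ∈ m, a ∣ 12)) → n ≤ 2 * m.card + 3 →
      ∃ σ : Perm (Fin n), σ ∈ alternatingGroup (Fin n) ∧
    (∀ x, σ x ≠ x) ∧ (σ ^ 20 = 1 ∨ σ ^ 12 = 1) ∧ n ≤ 2 * σ.cycleType.card + 3 := by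
    intro m h1 h2 h3 h4 h5
    obtain ⟨σ, hσ⟩ := (Perm.exists_with_cycleType_iff (Fin n) (m := m)).2
      ⟨by simp [h1], h2⟩
    refine ⟨σ, ?_, ?_, ?_, by rw [hσ]; exact h5⟩
    · rw [Perm.mem_alternatingGroup, Perm.sign_of_cycleType, hσ, h3.neg_one_pow]
    · have : σ.support.card = n := by rw [← Perm.sum_cycleType, hσ, h1]
      have : σ.support = Finset.univ := by
        apply Finset.eq_univ_of_card; simp [this]
      intro x
      exact Perm.mem_support.1 (by simp [this])
    · rcases h4 with h4 | h4
      · left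
        apply orderOf_dvd_iff_pow_eq_one.1
        rw [← Perm.lcm_cycleType, hσ]
        exact Multiset.lcm_dvd.2 h4
      · right
        apply orderOf_dvd_iff_pow_eq_one.1
        rw [← Perm.lcm_cycleType, hσ]
        exact Multiset.lcm_dvd.2 h4
  obtain ⟨j, hj⟩ : ∃ j, n = 4 * j ∨ n = 4 * j + 1 ∨ n = 4 * j + 2 ∨ n = 4 * j + 3 := ⟨n / 4, by omega⟩
  rcases hj with rfl | rfl | rfl | rfl
  · apply main (Multiset.replicate (2 * j) 2)
    · simp; omega
    · intro a ha; rw [Multiset.eq_of_mem_replicate ha]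
    · simp only [Multiset.sum_replicate, Multiset.card_replicate, smul_eq_mul]
      exact ⟨3 * j, by ring⟩
    · left; intro a ha; rw [Multiset.eq_of_mem_replicate ha]; norm_num
    · simp; omega
  · obtain ⟨i, rfl⟩ : ∃ i, j = i + 1 := ⟨j - 1, by omega⟩
    apply main (5 ::ₘ Multiset.replicate (2 * i) 2)
    · simp; omega
    · intro a ha
      rcases Multiset.mem_cons.1 ha with rfl | ha
      · norm_num
      · rw [Multiset.eq_of_mem_replicate ha]
    · simp only [Multiset.sum_cons, Multiset.card_cons, Multiset.sum_replicate, Multiset.card_replicate, smul_eq_mul]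
      exact ⟨3 * i + 3, by ring⟩
    · left; intro a ha
      rcases Multiset.mem_cons.1 ha with rfl | ha
      · norm_num
      · rw [Multiset.eq_of_mem_replicate ha]; norm_num
    · simp; omega
  · obtain ⟨i, rfl⟩ : ∃ i, j = i + 1 := ⟨j - 1, by omega⟩
    apply main (4 ::ₘ Multiset.replicate (2 * i + 1) 2)
    · simp; omega
    · intro a ha
      rcases Multiset.mem_cons.1 ha with rfl | ha
      · norm_num
      · rw [Multiset.eq_of_mem_replicate ha]
    · simp only [Multiset.sum_cons, Multiset.card_cons, Multiset.sum_replicate, Multiset.card_replicate, smul_eq_mul]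
      exact ⟨3 * i + 4, by ring⟩
    · left; intro a ha
      rcases Multiset.mem_cons.1 ha with rfl | ha
      · norm_num
      · rw [Multiset.eq_of_mem_replicate ha]; norm_num
    · simp; omega
  · apply main (3 ::ₘ Multiset.replicate (2 * j) 2)
    · simp; omega
    · intro a ha
      rcases Multiset.mem_cons.1 ha with rfl | ha
      · norm_num
      · rw [Multiset.eq_of_mem_replicate ha]
    · simp only [Multiset.sum_cons, Multiset.card_cons, Multiset.sum_replicate, Multiset.card_replicate, smul_eq_mul]
      exact ⟨3 * j + 2, by ring⟩
    · right; intro a ha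
      rcases Multiset.mem_cons.1 ha with rfl | ha
      · norm_num
      · rw [Multiset.eq_of_mem_replicate ha]; norm_num
    · simp; omega

lemma upper_main (n k q : ℕ) (hk : 2 ≤ k) (hq : 3 ≤ q) (hqo : Odd q)
    (hn : 2 * k * q + 1 < n ∨ (Odd k ∧ n = 2 * k * q + 1)) :
    ∃ σ ∈ alternatingGroup (Fin n), ∀ L : List (Perm (Fin n)), L.length = k →
      (∀ c ∈ L, c.IsCycle ∧ c.support.card = 3 * q) → σ ≠ L.prod := by
  have hkq : 6 ≤ k * q := by nlinarith
  have hn' : 2 * (k * q) + 1 < n ∨ (Odd k ∧ n = 2 * (k * q) + 1) := by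
    rwa [mul_assoc] at hn
  obtain ⟨σ, h1, h2, h3, h4⟩ := exists_bad n (by omega)
  refine ⟨σ, h1, ?_⟩
  rintro L hLk hL rfl
  obtain ⟨t, t1, t2⟩ := upper_list (by omega) (Odd.mul (by decide) hqo) L hL h2 h3
  rw [hLk] at t1 t2
  obtain ⟨q', rfl⟩ : ∃ i, q = i + 1 := ⟨q - 1, by omega⟩
  have e1 : k * (3 * (q' + 1) - 1) = 3 * (k * (q' + 1)) - k := by
    rw [Nat.mul_sub]; ring_nf
  rw [e1, Fintype.card_fin] at t1
  have e2 : k ≤ k * (q' + 1) := by nlinarith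
  generalize k * (q' + 1) = z at *
  rcases hn' with h | ⟨⟨i, rfl⟩, h⟩ <;> omega

lemma ais (f : Perm α) (x : α) : f (f⁻¹ x) = x := f.apply_symm_apply x

def CyS (A : Perm α) (S : Finset α) : Prop :=
  (∀ x, x ∉ S → A x = x) ∧ ∀ x ∈ S, ∀ y ∈ S, A.SameCycle x y

lemma sameCycle_mono {σ τ : Perm α} (h : ∀ z, τ.SameCycle z (σ z)) {x y : α}
    (hs : σ.SameCycle x y) : τ.SameCycle x y := by
  obtain ⟨n, -, rfl⟩ := hs.exists_pow_eq'
  clear hs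
  induction n with
  | zero => exact Perm.SameCycle.refl _ _
  | succ n ih => rw [pow_succ', Perm.mul_apply]; exact ih.trans (h _)

lemma ins_step {σ : Perm α} {y p : α} (hp : σ p = p) (hy : y ≠ p) (z : α) :
    (σ * swap y p).SameCycle z (σ z) := by
  by_cases h1 : z = y
  · subst h1
    refine ⟨((2 : ℕ) : ℤ), ?_⟩
    rw [zpow_natCast, pow_two]
    simp [Perm.mul_apply, hp]
  by_cases h2 : z = p
  · subst h2; rw [hp]
  · refine ⟨1, ?_⟩
    simp [Perm.mul_apply, swap_apply_of_ne_of_ne h1 h2]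

lemma ins_sameCycle {σ : Perm α} {y p : α} (hp : σ p = p) :
    (σ * swap y p).SameCycle y p :=
  ⟨1, by simp [Perm.mul_apply, hp]⟩

lemma CyS.ext_right {A : Perm α} {S : Finset α} (h : CyS A S) {x p : α} (hx : x ∈ S)
    (hp : p ∉ S) : CyS (A * swap x p) (insert p S) := by
  have hpx : x ≠ p := by rintro rfl; exact hp hx
  refine ⟨fun z hz => ?_, ?_⟩
  · rw [Finset.mem_insert, not_or] at hz
    rw [Perm.mul_apply, swap_apply_of_ne_of_ne (by rintro rfl; exact hz.2 hx) hz.1, h.1 z hz.2]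
  · have key : ∀ z ∈ insert p S, (A * swap x p).SameCycle x z := by
      intro z hz
      rcases Finset.mem_insert.1 hz with rfl | hz
      · exact ins_sameCycle (h.1 _ hp)
      · exact sameCycle_mono (ins_step (h.1 _ hp) hpx) (h.2 x hx z hz)
    intro u hu v hv
    exact (key u hu).symm.trans (key v hv)

lemma CyS.inv_mem {A : Perm α} {S : Finset α} (h : CyS A S) {x : α} (hx : x ∈ S) : A⁻¹ x ∈ S := by
  by_contra hn
  have := h.1 _ hn
  rw [ais] at this
  exact hn (this ▸ hx)

lemma CyS.ext_left {A : Perm α} {S : Finset α} (h : CyS A S) {x p : α} (hx : x ∈ S)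
    (hp : p ∉ S) : CyS (swap x p * A) (insert p S) := by
  have := h.ext_right (h.inv_mem hx) hp
  rwa [Equiv.mul_swap_eq_swap_mul, h.1 p hp, ais] at this

lemma CyS.conj {A : Perm α} {S : Finset α} (h : CyS A S) (γ : Perm α) :
    CyS (γ * A * γ⁻¹) (S.map γ.toEmbedding) := by
  have hm : ∀ x, x ∈ S.map γ.toEmbedding ↔ γ⁻¹ x ∈ S := by
    intro x
    constructor
    · intro hx
      obtain ⟨y, hy, rfl⟩ := Finset.mem_map.1 hx
      simpa using hy
    · intro hx
      exact Finset.mem_map.2 ⟨_, hx, by simp⟩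
  refine ⟨fun x hx => ?_, fun x hx y hy => ?_⟩
  · rw [hm] at hx
    rw [Perm.mul_apply, Perm.mul_apply, h.1 _ hx, ais]
  · rw [hm] at hx hy
    exact Perm.sameCycle_conj.2 (h.2 _ hx _ hy)

/-- The pair structure. -/
def GoodW (X : Finset α) (σ A B : Perm α) (S T : Finset α) : Prop :=
  CyS A S ∧ CyS B T ∧ σ = A * B ∧ S ⊆ X ∧ T ⊆ X ∧ ∀ z ∈ X, ∃ w, w ∈ S ∧ w ∈ T ∧ σ.SameCycle z w

def Good (X : Finset α) (σ : Perm α) (l₁ l₂ : ℕ) : Prop :=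
  ∃ A B S T, GoodW X σ A B S T ∧ S.card = l₁ ∧ T.card = l₂

lemma GoodW.fix {X : Finset α} {σ A B : Perm α} {S T : Finset α} (h : GoodW X σ A B S T) {p : α}
    (hp : p ∉ X) : A p = p ∧ B p = p ∧ σ p = p := by
  obtain ⟨h1, h2, h3, h4, h5, -⟩ := h
  have ha := h1.1 p (fun h => hp (h4 h))
  have hb := h2.1 p (fun h => hp (h5 h))
  exact ⟨ha, hb, by rw [h3, Perm.mul_apply, hb, ha]⟩

/-- move so that a given point lies in both supports -/
lemma GoodW.move {X : Finset α} {σ A B : Perm α} {S T : Finset α} (h : GoodW X σ A B S T) {y : α}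
    (hy : y ∈ X) : ∃ A' B' S' T', GoodW X σ A' B' S' T' ∧ S'.card = S.card ∧ T'.card = T.card ∧
      y ∈ S' ∧ y ∈ T' := by
  have hfix := fun p (hp : p ∉ X) => (h.fix hp).2.2
  obtain ⟨h1, h2, h3, h4, h5, h6⟩ := h
  obtain ⟨w, hwS, hwT, hw⟩ := h6 y hy
  obtain ⟨j, hj⟩ := hw.symm
  set γ := σ ^ j with hγ
  have hc : γ * σ * γ⁻¹ = σ := by
    rw [hγ, (Commute.zpow_self σ j).eq, mul_inv_cancel_right]
  have hX : ∀ x ∈ X, γ x ∈ X := by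
    intro x hx
    by_contra hn
    have h1 : γ (γ x) = γ x := by
      rw [hγ]; exact Perm.zpow_apply_eq_self_of_apply_eq_self (hfix _ hn) j
    exact hn ((γ.injective h1).symm ▸ hx)
  refine ⟨γ * A * γ⁻¹, γ * B * γ⁻¹, S.map γ.toEmbedding, T.map γ.toEmbedding,
    ⟨h1.conj γ, h2.conj γ, ?_, ?_, ?_, ?_⟩, by simp, by simp, ?_, ?_⟩
  · rw [← hc, h3]; group
  · intro x hx
    obtain ⟨z, hz, rfl⟩ := Finset.mem_map.1 hx
    exact hX _ (h4 hz)
  · intro x hx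
    obtain ⟨z, hz, rfl⟩ := Finset.mem_map.1 hx
    exact hX _ (h5 hz)
  · intro z hz
    obtain ⟨w, a, b, c⟩ := h6 z hz
    refine ⟨γ w, Finset.mem_map_of_mem _ a, Finset.mem_map_of_mem _ b, c.trans ⟨j, rfl⟩⟩
  · rw [← hj]; exact Finset.mem_map_of_mem _ hwS
  · rw [← hj]; exact Finset.mem_map_of_mem _ hwT

/-- adding a fixed point -/
lemma GoodW.add_fix {X : Finset α} {σ A B : Perm α} {S T : Finset α} (h : GoodW X σ A B S T)
    {p : α} (hp : p ∉ X) : ∃ A' B', GoodW (insert p X) σ A' B' (insert p S) (insert p T) := by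
  have hpS : p ∉ S := fun h' => hp (h.2.2.2.1 h')
  have hpT : p ∉ T := fun h' => hp (h.2.2.2.2.1 h')
  obtain ⟨h1, h2, h3, h4, h5, h6⟩ := h
  have hsub : (∀ z ∈ insert p X, ∃ w, w ∈ insert p S ∧ w ∈ insert p T ∧ σ.SameCycle z w) := by
    intro z hz
    rcases Finset.mem_insert.1 hz with rfl | hz
    · exact ⟨z, by simp, by simp, Perm.SameCycle.refl _ _⟩
    · obtain ⟨w, a, b, c⟩ := h6 z hz
      exact ⟨w, by simp [a], by simp [b], c⟩
  rcases X.eq_empty_or_nonempty with hX | ⟨z, hz⟩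
  · have hS : S = ∅ := Finset.subset_empty.1 (hX ▸ h4)
    have hT : T = ∅ := Finset.subset_empty.1 (hX ▸ h5)
    subst hS hT
    refine ⟨A, B, ⟨fun x _ => h1.1 x (by simp), ?_⟩, ⟨fun x _ => h2.1 x (by simp), ?_⟩, h3,
      Finset.insert_subset_insert _ h4, Finset.insert_subset_insert _ h5, hsub⟩
    · intro x hx y hy
      simp only [insert_empty_eq, Finset.mem_singleton] at hx hy
      rw [hx, hy]
    · intro x hx y hy
      simp only [insert_empty_eq, Finset.mem_singleton] at hx hy
      rw [hx, hy]
  · obtain ⟨w, a, b, c⟩ := h6 z hz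
    refine ⟨A * swap w p, swap w p * B, h1.ext_right a hpS, h2.ext_left b hpT, ?_,
      Finset.insert_subset_insert _ h4, Finset.insert_subset_insert _ h5, hsub⟩
    rw [h3, mul_assoc, swap_mul_self_mul]

lemma Good.add_fix {X : Finset α} {σ : Perm α} {l₁ l₂ : ℕ} (h : Good X σ l₁ l₂)
    {p : α} (hp : p ∉ X) : Good (insert p X) σ (l₁ + 1) (l₂ + 1) := by
  obtain ⟨A, B, S, T, h, rfl, rfl⟩ := h
  have hpS : p ∉ S := fun h' => hp (h.2.2.2.1 h')
  have hpT : p ∉ T := fun h' => hp (h.2.2.2.2.1 h')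
  obtain ⟨A', B', h'⟩ := h.add_fix hp
  exact ⟨A', B', _, _, h', Finset.card_insert_of_notMem hpS, Finset.card_insert_of_notMem hpT⟩

lemma Good.ins_right {X : Finset α} {σ : Perm α} {l₁ l₂ : ℕ} (h : Good X σ l₁ l₂)
    {y p : α} (hp : p ∉ X) (hy : y ∈ X) : Good (insert p X) (σ * swap y p) l₁ (l₂ + 1) := by
  obtain ⟨A, B, S, T, h, rfl, rfl⟩ := h
  obtain ⟨A, B, S', T', h, hS, hT, hyS, hyT⟩ := h.move hy
  have hfix := (h.fix hp).2.2
  have hyp : y ≠ p := by rintro rfl; exact hp hy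
  obtain ⟨h1, h2, h3, h4, h5, h6⟩ := h
  have hpT : p ∉ T' := fun h' => hp (h5 h')
  refine ⟨A, B * swap y p, S', insert p T', ⟨h1, h2.ext_right hyT hpT, by rw [h3, mul_assoc],
    h4.trans (Finset.subset_insert _ _), Finset.insert_subset_insert _ h5, ?_⟩, hS,
    by rw [Finset.card_insert_of_notMem hpT, hT]⟩
  intro z hz
  rcases Finset.mem_insert.1 hz with rfl | hz
  · exact ⟨y, hyS, by simp [hyT], (ins_sameCycle hfix).symm⟩
  · obtain ⟨w, a, b, c⟩ := h6 z hz
    exact ⟨w, a, by simp [b], sameCycle_mono (ins_step hfix hyp) c⟩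

lemma Good.ins_left {X : Finset α} {σ : Perm α} {l₁ l₂ : ℕ} (h : Good X σ l₁ l₂)
    {y p : α} (hp : p ∉ X) (hy : y ∈ X) : Good (insert p X) (σ * swap y p) (l₁ + 1) l₂ := by
  obtain ⟨A, B, S, T, h, rfl, rfl⟩ := h
  have hσy : σ y ∈ X := by
    by_contra hn
    exact hn ((σ.injective (h.fix hn).2.2).symm ▸ hy)
  obtain ⟨A, B, S', T', h, hS, hT, hyS, hyT⟩ := h.move hσy
  have hfix := (h.fix hp).2.2
  have hyp : y ≠ p := by rintro rfl; exact hp hy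
  obtain ⟨h1, h2, h3, h4, h5, h6⟩ := h
  have hpS : p ∉ S' := fun h' => hp (h4 h')
  refine ⟨swap (σ y) p * A, B, insert p S', T', ⟨h1.ext_left hyS hpS, h2, ?_,
    Finset.insert_subset_insert _ h4, h5.trans (Finset.subset_insert _ _), ?_⟩,
    by rw [Finset.card_insert_of_notMem hpS, hS], hT⟩
  · rw [mul_assoc, ← h3, Equiv.mul_swap_eq_swap_mul, hfix]
  intro z hz
  rcases Finset.mem_insert.1 hz with rfl | hz
  · exact ⟨σ y, by simp [hyS], hyT, ((ins_sameCycle hfix).symm).trans (ins_step hfix hyp y)⟩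
  · obtain ⟨w, a, b, c⟩ := h6 z hz
    exact ⟨w, by simp [a], b, sameCycle_mono (ins_step hfix hyp) c⟩

lemma Good.ins_two {X : Finset α} {σ : Perm α} {l₁ l₂ : ℕ} (h : Good X σ l₁ l₂)
    {y p v : α} (hp : p ∉ X) (hv : v ∉ X) (hpv : p ≠ v) (hy : y ∈ X) :
    Good (insert v (insert p X)) (σ * swap y p * swap p v) (l₁ + 2) (l₂ + 2) := by
  obtain ⟨A, B, S, T, h, rfl, rfl⟩ := h
  have hσy : σ y ∈ X := by
    by_contra hn
    exact hn ((σ.injective (h.fix hn).2.2).symm ▸ hy)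
  obtain ⟨A, B, S', T', h, hS, hT, hyS, hyT⟩ := h.move hσy
  have hfix := (h.fix hp).2.2
  have hfixv := (h.fix hv).2.2
  have hyp : y ≠ p := by rintro rfl; exact hp hy
  have hvS : v ∉ S' := fun h' => hv (h.2.2.2.1 h')
  have hvT : v ∉ T' := fun h' => hv (h.2.2.2.2.1 h')
  have hpS : p ∉ S' := fun h' => hp (h.2.2.2.1 h')
  have hpT : p ∉ T' := fun h' => hp (h.2.2.2.2.1 h')
  obtain ⟨A, B, h⟩ := h.add_fix hv
  obtain ⟨h1, h2, h3, h4, h5, h6⟩ := h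
  have hpS' : p ∉ insert v S' := by simp [hpS, hpv]
  have hpT' : p ∉ insert v T' := by simp [hpT, hpv]
  refine ⟨swap (σ y) p * A, B * swap v p, insert p (insert v S'), insert p (insert v T'),
    ⟨h1.ext_left (by simp [hyS]) hpS', h2.ext_right (by simp) hpT', ?_,
    ?_, ?_, ?_⟩, ?_, ?_⟩
  · rw [← mul_assoc, mul_assoc _ A, ← h3, Equiv.mul_swap_eq_swap_mul σ y p, hfix, swap_comm p v]
  · rw [Finset.insert_comm v p]; exact Finset.insert_subset_insert _ h4
  · rw [Finset.insert_comm v p]; exact Finset.insert_subset_insert _ h5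
  · intro z hz
    by_cases hzv : z = v
    · exact ⟨z, by simp [hzv], by simp [hzv], Perm.SameCycle.refl _ _⟩
    by_cases hzp : z = p
    · exact ⟨z, by simp [hzp], by simp [hzp], Perm.SameCycle.refl _ _⟩
    obtain ⟨w, a, b, c⟩ := h6 z (by simpa [hzv, hzp] using hz)
    refine ⟨w, by simp [a], by simp [b], ?_⟩
    refine sameCycle_mono (ins_step ?_ hpv) (sameCycle_mono (ins_step hfix hyp) c)
    rw [Perm.mul_apply, swap_apply_of_ne_of_ne _ hpv.symm, hfixv]
    rintro rfl; exact hv hy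
  · rw [Finset.card_insert_of_notMem hpS', Finset.card_insert_of_notMem hvS, hS]
  · rw [Finset.card_insert_of_notMem hpT', Finset.card_insert_of_notMem hvT, hT]

/-- all reachable pairs of lengths -/
def PL (X : Finset α) (σ : Perm α) (c D : ℕ) : Prop :=
  c + 2 * D ≤ X.card ∧ ∀ g ≤ D, ∀ l₁ l₂, l₁ + l₂ = X.card + c + 2 * g → c + 2 * g ≤ l₁ →
    c + 2 * g ≤ l₂ → Good X σ l₁ l₂

lemma PL_empty : PL (∅ : Finset α) 1 0 0 := by
  refine ⟨by simp, fun g hg l₁ l₂ h _ _ => ?_⟩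
  simp only [Finset.card_empty] at h
  obtain ⟨rfl, rfl⟩ : l₁ = 0 ∧ l₂ = 0 := by omega
  exact ⟨1, 1, ∅, ∅, ⟨⟨by simp, by simp⟩, ⟨by simp, by simp⟩, by simp, by simp, by simp, by simp⟩,
    rfl, rfl⟩

lemma PL.add_fix {X : Finset α} {σ : Perm α} {c D : ℕ} (h : PL X σ c D) {p : α} (hp : p ∉ X) :
    PL (insert p X) σ (c + 1) D := by
  have hc := Finset.card_insert_of_notMem hp
  refine ⟨by have := h.1; omega, fun g hg l₁ l₂ e h1 h2 => ?_⟩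
  obtain ⟨a, rfl⟩ : ∃ a, l₁ = a + 1 := ⟨l₁ - 1, by omega⟩
  obtain ⟨b, rfl⟩ : ∃ b, l₂ = b + 1 := ⟨l₂ - 1, by omega⟩
  exact (h.2 g hg a b (by omega) (by omega) (by omega)).add_fix hp

lemma PL.ins {X : Finset α} {σ : Perm α} {c D : ℕ} (h : PL X σ c D) {y p : α} (hp : p ∉ X)
    (hy : y ∈ X) : PL (insert p X) (σ * swap y p) c D := by
  have hc := Finset.card_insert_of_notMem hp
  refine ⟨by have := h.1; omega, fun g hg l₁ l₂ e h1 h2 => ?_⟩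
  have := h.1
  by_cases hl : c + 2 * g < l₁
  · obtain ⟨a, rfl⟩ : ∃ a, l₁ = a + 1 := ⟨l₁ - 1, by omega⟩
    exact (h.2 g hg a l₂ (by omega) (by omega) (by omega)).ins_left hp hy
  · obtain ⟨b, rfl⟩ : ∃ b, l₂ = b + 1 := ⟨l₂ - 1, by omega⟩
    exact (h.2 g hg l₁ b (by omega) (by omega) (by omega)).ins_right hp hy

lemma PL.ins_two {X : Finset α} {σ : Perm α} {c D : ℕ} (h : PL X σ c D) {y p v : α} (hp : p ∉ X)
    (hv : v ∉ X) (hpv : p ≠ v) (hy : y ∈ X) :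
    PL (insert v (insert p X)) (σ * swap y p * swap p v) c (D + 1) := by
  have hv' : v ∉ insert p X := by simp [hv, hpv.symm]
  have hc := Finset.card_insert_of_notMem hp
  have hc' := Finset.card_insert_of_notMem hv'
  have h' := (h.ins hp hy).ins hv' (Finset.mem_insert_self p X)
  refine ⟨by have := h.1; omega, fun g hg l₁ l₂ e h1 h2 => ?_⟩
  by_cases hgD : g ≤ D
  · exact h'.2 g hgD l₁ l₂ e h1 h2
  · obtain ⟨a, rfl⟩ : ∃ a, l₁ = a + 2 := ⟨l₁ - 2, by omega⟩
    obtain ⟨b, rfl⟩ : ∃ b, l₂ = b + 2 := ⟨l₂ - 2, by omega⟩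
    exact (h.2 D le_rfl a b (by omega) (by omega) (by omega)).ins_two hp hv hpv hy

lemma PL.ins_list : ∀ (n : ℕ) (R : List α), R.length = n → ∀ {X : Finset α} {σ : Perm α} {c D : ℕ},
    PL X σ c D → ∀ {y : α}, y ∈ X → R.Nodup → (∀ z ∈ R, z ∉ X) →
    PL (X ∪ R.toFinset) (σ * (y :: R).formPerm) c (D + R.length / 2) := by
  intro n
  induction n using Nat.strong_induction_on with
  | _ n ih =>
    intro R hR X σ c D h y hy hnd hdis
    match R, hR with
    | [], _ => simpa using h
    | [z], _ =>
      have := h.ins (hdis z (by simp)) hy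
      have e1 : X ∪ [z].toFinset = insert z X := by
        ext w; simp
      rw [e1]
      simpa using this
    | z :: v :: R, hR =>
      have hzv : z ≠ v := by rintro rfl; simp at hnd
      have h2 := h.ins_two (hdis z (by simp)) (hdis v (by simp)) hzv hy
      have h3 := ih R.length (by simp at hR; omega) R rfl h2 (y := v) (by simp)
        hnd.of_cons.of_cons (by
          intro w hw
          have := hdis w (by simp [hw])
          simp only [Finset.mem_insert, not_or]
          refine ⟨?_, ?_, this⟩
          · rintro rfl; simp [hw] at hnd
          · rintro rfl; simp [hw] at hnd)
      have e1 : X ∪ (z :: v :: R).toFinset = insert v (insert z X) ∪ R.toFinset := by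
        ext w; simp; tauto
      have e2 : D + (z :: v :: R).length / 2 = D + 1 + R.length / 2 := by
        simp only [List.length_cons]; omega
      rw [e1, e2, List.formPerm_cons_cons, List.formPerm_cons_cons, ← mul_assoc, ← mul_assoc]
      exact h3

lemma PL_support (σ : Perm α) : ∃ D, PL σ.support σ σ.cycleType.card D ∧
    σ.support.card ≤ 2 * σ.cycleType.card + 4 * D := by
  have step : ∀ C τ : Perm α, C.Disjoint τ → C.IsCycle →
      (∃ D, PL τ.support τ τ.cycleType.card D ∧ τ.support.card ≤ 2 * τ.cycleType.card + 4 * D) →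
      ∃ D, PL (C * τ).support (C * τ) (C * τ).cycleType.card D ∧
        (C * τ).support.card ≤ 2 * (C * τ).cycleType.card + 4 * D := by
    rintro C τ hd hC ⟨D, hD, hle⟩
    obtain ⟨L, L1, L2, L3, L4⟩ := exists_list C hC
    have hcard : (C * τ).cycleType.card = τ.cycleType.card + 1 := by
      rw [hd.cycleType_mul, Multiset.card_add, hC.cycleType, add_comm]; rfl
    have hsc := hd.card_support_mul
    have hC2 := hC.two_le_card_support
    have hdis : ∀ z ∈ L, z ∉ τ.support := fun z hz =>
      Finset.disjoint_left.1 hd.disjoint_support ((L4 z).1 hz)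
    match L, L1, L2, L3, L4, hdis with
    | [], _, _, L3, _, _ => simp only [List.length_nil] at L3; omega
    | y :: R, L1, L2, L3, L4, hdis =>
      have h1 := hD.add_fix (hdis y (by simp))
      have h2 := PL.ins_list R.length R rfl h1 (y := y) (by simp) L1.of_cons (by
        intro z hz
        have := hdis z (by simp [hz])
        simp only [Finset.mem_insert, not_or]
        refine ⟨?_, this⟩
        rintro rfl; simp [hz] at L1)
      have e1 : (C * τ).support = insert y τ.support ∪ R.toFinset := by
        rw [hd.support_mul]
        ext w
        rw [Finset.mem_union, ← L4, Finset.mem_union, Finset.mem_insert, List.mem_toFinset,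
          List.mem_cons]
        tauto
      refine ⟨D + R.length / 2, ?_, ?_⟩
      · rw [hcard, e1, hd.commute.eq, ← L2]; exact h2
      · rw [hsc, hcard]
        have L3' : R.length + 1 = C.support.card := by rw [← L3]; rfl
        omega
  refine Perm.cycle_induction_on (fun σ => ∃ D, PL σ.support σ σ.cycleType.card D ∧
    σ.support.card ≤ 2 * σ.cycleType.card + 4 * D) σ ?_ ?_ ?_
  · exact ⟨0, by simpa using PL_empty, by simp⟩
  · intro C hC
    have := step C 1 (Perm.disjoint_one_right _) hC ⟨0, by simpa using PL_empty, by simp⟩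
    simpa using this
  · intro C τ hd hC _ h
    exact step C τ hd hC h

lemma PL_superset (σ : Perm α) : ∃ D, σ.support.card ≤ 2 * σ.cycleType.card + 4 * D ∧
    ∀ X : Finset α, σ.support ⊆ X → PL X σ (σ.cycleType.card + (X.card - σ.support.card)) D := by
  obtain ⟨D, h1, h2⟩ := PL_support σ
  refine ⟨D, h2, ?_⟩
  have : ∀ F : Finset α, _root_.Disjoint F σ.support →
      PL (F ∪ σ.support) σ (σ.cycleType.card + F.card) D := by
    intro F
    induction F using Finset.induction_on with
    | empty => intro _; simpa using h1
    | insert p F hp ih =>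
      intro hd
      rw [Finset.disjoint_insert_left] at hd
      rw [Finset.insert_union, Finset.card_insert_of_notMem hp, ← add_assoc]
      exact (ih hd.2).add_fix (by simp [hp, hd.1])
  intro X hX
  have := this (X \ σ.support) Finset.sdiff_disjoint
  rwa [Finset.sdiff_union_of_subset hX, Finset.card_sdiff_of_subset hX] at this

lemma CyS.cyc {A : Perm α} {S : Finset α} (h : CyS A S) (hS : 2 ≤ S.card) :
    A.IsCycle ∧ A.support = S := by
  have hne : ∀ x ∈ S, A x ≠ x := by
    intro x hx hf
    obtain ⟨y, hy, hyx⟩ := Finset.exists_mem_ne (by omega : 1 < S.card) x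
    obtain ⟨j, hj⟩ := h.2 x hx y hy
    rw [Perm.zpow_apply_eq_self_of_apply_eq_self hf] at hj
    exact hyx hj.symm
  have hsup : A.support = S := by
    ext x
    rw [Perm.mem_support]
    constructor
    · intro hx
      by_contra hn
      exact hx (h.1 x hn)
    · exact hne x
  obtain ⟨x, hx⟩ : S.Nonempty := Finset.card_pos.1 (by omega)
  refine ⟨⟨x, hne x hx, fun y hy => h.2 x hx y ?_⟩, hsup⟩
  rw [← hsup]; exact Perm.mem_support.2 hy

/-- product of `k` cycles of length `l` -/
def IsP (l k : ℕ) (σ : Perm α) : Prop :=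
  ∃ L : List (Perm α), L.length = k ∧ (∀ d ∈ L, d.IsCycle ∧ d.support.card = l) ∧ σ = L.prod

lemma IsP.mul {l j k : ℕ} {σ τ : Perm α} (h : IsP l j σ) (h' : IsP l k τ) :
    IsP l (j + k) (σ * τ) := by
  obtain ⟨L, h1, h2, rfl⟩ := h
  obtain ⟨L', h1', h2', rfl⟩ := h'
  refine ⟨L ++ L', by simp [h1, h1'], ?_, by simp⟩
  intro d hd
  rcases List.mem_append.1 hd with hd | hd
  · exact h2 d hd
  · exact h2' d hd

lemma Good.isP {X : Finset α} {σ : Perm α} {l : ℕ} (hl : 2 ≤ l) (h : Good X σ l l) :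
    IsP l 2 σ := by
  obtain ⟨A, B, S, T, h, hS, hT⟩ := h
  obtain ⟨a1, a2⟩ := h.1.cyc (by omega)
  obtain ⟨b1, b2⟩ := h.2.1.cyc (by omega)
  refine ⟨[A, B], rfl, ?_, by simp [h.2.2.1]⟩
  intro d hd
  simp only [List.mem_cons, List.not_mem_nil, or_false] at hd
  rcases hd with rfl | rfl
  · exact ⟨a1, by rw [a2, hS]⟩
  · exact ⟨b1, by rw [b2, hT]⟩

lemma sign_iff (σ : Perm α) :
    Perm.sign σ = 1 ↔ Even (σ.support.card + σ.cycleType.card) := by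
  rw [Perm.sign_of_cycleType, Perm.sum_cycleType]
  constructor
  · intro h
    by_contra hn
    rw [Nat.not_even_iff_odd] at hn
    rw [hn.neg_one_pow] at h
    exact absurd h (by decide)
  · intro h
    exact h.neg_one_pow

lemma two_card (σ : Perm α) : 2 * σ.cycleType.card ≤ σ.support.card := by
  rw [← Perm.sum_cycleType, mul_comm]
  exact Multiset.card_nsmul_le_sum (fun x hx => Perm.two_le_of_mem_cycleType hx)

lemma two_lemma {σ : Perm α} {l : ℕ} (hl : 2 ≤ l) (hs : Perm.sign σ = 1)
    (h1 : σ.support.card + σ.cycleType.card ≤ 2 * l)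
    (h2 : 2 * l + σ.support.card ≤ 2 * Fintype.card α + σ.cycleType.card) : IsP l 2 σ := by
  rw [sign_iff] at hs
  have h3 := two_card σ
  obtain ⟨D, -, hD⟩ := PL_superset σ
  obtain ⟨z, hz⟩ := hs
  obtain ⟨X, hX, -, hXc⟩ := Finset.exists_subsuperset_card_eq (Finset.subset_univ σ.support)
    (n := l + (z - σ.cycleType.card)) (by omega) (by rw [Finset.card_univ]; omega)
  exact ((hD X hX).2 0 (Nat.zero_le _) l l (by omega) (by omega) (by omega)).isP hl

lemma two_full {σ : Perm α} {q : ℕ} (hq : 1 ≤ q) (hs : Perm.sign σ = 1)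
    (hα : Fintype.card α = 4 * q) : IsP (3 * q) 2 σ := by
  have hs' := hs
  rw [sign_iff] at hs'
  obtain ⟨z, hz⟩ := hs'
  have h3 := two_card σ
  have h4 : σ.support.card ≤ 4 * q := hα ▸ Finset.card_le_univ _
  by_cases hc : σ.cycleType.card + (4 * q - σ.support.card) ≤ 2 * q
  · obtain ⟨D, h5, hD⟩ := PL_superset σ
    have := (hD Finset.univ (Finset.subset_univ _))
    rw [Finset.card_univ, hα] at this
    exact (this.2 ((2 * q - (σ.cycleType.card + (4 * q - σ.support.card))) / 2) (by omega)
      (3 * q) (3 * q) (by rw [Finset.card_univ, hα]; omega) (by omega) (by omega)).isP (by omega)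
  · exact two_lemma (by omega) hs (by omega) (by omega)

lemma cyc_sign {A : Perm α} (h : A.IsCycle) : A.cycleType.card = 1 := by
  rw [h.cycleType]; rfl

lemma three_lemma {σ : Perm α} {q : ℕ} (hq : 1 ≤ q) (hqo : Odd q) (hs : Perm.sign σ = 1)
    (hα : 6 * q ≤ Fintype.card α) (hm : σ.support.card ≤ 6 * q) : IsP (3 * q) 3 σ := by
  have hs' := hs
  rw [sign_iff] at hs'
  obtain ⟨z, hz⟩ := hs'
  obtain ⟨t, ht⟩ := hqo
  have h3 := two_card σ
  obtain ⟨D, -, hD⟩ := PL_superset σ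
  obtain ⟨X, hX, -, hXc⟩ := Finset.exists_subsuperset_card_eq (Finset.subset_univ σ.support)
    (n := max σ.support.card (3 * q)) (by omega) (by rw [Finset.card_univ]; omega)
  obtain ⟨A, B, S, T, h, hS, hT⟩ := (hD X hX).2 0 (Nat.zero_le _)
    (X.card + (σ.cycleType.card + (X.card - σ.support.card)) - 3 * q) (3 * q)
    (by omega) (by omega) (by omega)
  obtain ⟨b1, b2⟩ := h.2.1.cyc (by omega)
  have hB : IsP (3 * q) 1 B := ⟨[B], rfl, by simp [b1, b2, hT], by simp⟩
  have hBs : Perm.sign B = 1 := by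
    rw [sign_iff, b2, hT, cyc_sign b1]; exact ⟨3 * t + 2, by omega⟩
  have hAs : Perm.sign A = 1 := by
    have := congrArg Perm.sign h.2.2.1
    rwa [hs, map_mul, hBs, mul_one, eq_comm] at this
  have hA : IsP (3 * q) 2 A := by
    by_cases hc : 2 ≤ S.card
    · obtain ⟨a1, a2⟩ := h.1.cyc hc
      have := cyc_sign a1
      have h6 := (sign_iff A).1 hAs
      rw [a2, this] at h6
      obtain ⟨y, hy⟩ := h6
      exact two_lemma (by omega) hAs (by rw [a2, this]; omega) (by rw [a2, this]; omega)
    · have hA1 : A = 1 := by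
        ext x
        by_cases hx : x ∈ S
        · have hAx : A x ∈ S := by
            by_contra hn
            exact hn ((A.injective (h.1.1 _ hn)).symm ▸ hx)
          exact Finset.card_le_one.1 (by omega) _ hAx _ hx
        · exact h.1.1 x hx
      subst hA1
      exact two_lemma (by omega) hAs (by simp) (by simp; omega)
  rw [h.2.2.1]
  exact hA.mul hB

lemma extract {σ : Perm α} {a : ℕ} (ha : a ∈ σ.cycleType) : ∃ c τ : Perm α, c.IsCycle ∧
    c.support.card = a ∧ c.Disjoint τ ∧ σ = c * τ ∧ σ.cycleType = a ::ₘ τ.cycleType := by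
  rw [Perm.cycleType_def, Multiset.mem_map] at ha
  obtain ⟨c, hc, rfl⟩ := ha
  have hc' : c ∈ σ.cycleFactorsFinset := hc
  have hcyc := (Perm.mem_cycleFactorsFinset_iff.1 hc').1
  have hd := (Perm.disjoint_mul_inv_of_mem_cycleFactorsFinset hc').symm
  have he : σ = c * (σ * c⁻¹) := by rw [hd.commute.eq]; group
  refine ⟨c, σ * c⁻¹, hcyc, rfl, hd, he, ?_⟩
  conv_lhs => rw [he]
  rw [hd.cycleType_mul, hcyc.cycleType]; rfl

lemma split_ct (P : Multiset ℕ) : ∀ (Q : Multiset ℕ) (σ : Perm α), σ.cycleType = P + Q →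
    ∃ σ₁ σ₂ : Perm α, σ₁.Disjoint σ₂ ∧ σ = σ₁ * σ₂ ∧ σ₁.cycleType = P ∧ σ₂.cycleType = Q := by
  induction P using Multiset.induction_on with
  | empty =>
    intro Q σ h
    exact ⟨1, σ, Perm.disjoint_one_left _, by simp, by simp, by simpa using h⟩
  | cons a P ih =>
    intro Q σ h
    obtain ⟨c, τ, h1, h2, h3, h4, h5⟩ := extract (σ := σ) (a := a) (by rw [h]; simp)
    rw [h5, Multiset.cons_add, Multiset.cons_inj_right] at h
    obtain ⟨τ₁, τ₂, d1, d2, d3, d4⟩ := ih Q τ h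
    have h3' := h3.disjoint_support
    rw [d2, d1.support_mul, Finset.disjoint_union_right] at h3'
    have e1 := Perm.disjoint_iff_disjoint_support.2 h3'.1
    have e2 := Perm.disjoint_iff_disjoint_support.2 h3'.2
    refine ⟨c * τ₁, τ₂, e2.mul_left d1, by rw [h4, d2, mul_assoc], ?_, d4⟩
    rw [e1.cycleType_mul, d3, h1.cycleType, h2]; rfl

lemma cut {c : Perm α} (hc : c.IsCycle) {b : ℕ} (hb : 2 ≤ b) (hb' : b < c.support.card) :
    ∃ A B : Perm α, c = A * B ∧ A.IsCycle ∧ A.support.card = b ∧ A.support ⊆ c.support ∧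
      B.support.card ≤ c.support.card - b + 1 := by
  obtain ⟨D, -, hD⟩ := PL_superset c
  have h1 := cyc_sign hc
  obtain ⟨A, B, S, T, h, hS, hT⟩ := (hD _ (Finset.Subset.refl _)).2 0 (Nat.zero_le _) b
    (c.support.card - b + 1) (by omega) (by omega) (by omega)
  obtain ⟨a1, a2⟩ := h.1.cyc (by omega)
  obtain ⟨b1, b2⟩ := h.2.1.cyc (by omega)
  exact ⟨A, B, h.2.2.1, a1, by rw [a2, hS], by rw [a2]; exact h.2.2.2.1, by rw [b2, hT]⟩

lemma three_card (P : Multiset ℕ) (h : ∀ x ∈ P, 2 ≤ x) :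
    3 * P.card ≤ P.sum + P.count 2 := by
  induction P using Multiset.induction_on with
  | empty => simp
  | cons a P ih =>
    have := ih (fun x hx => h x (Multiset.mem_cons_of_mem hx))
    have ha := h a (Multiset.mem_cons_self _ _)
    by_cases h2 : a = 2
    · subst h2; simp; omega
    · rw [Multiset.count_cons_of_ne (Ne.symm h2)]; simp; omega

lemma exists_split (W : ℕ) : ∀ (L : List ℕ) (_ : W < L.sum + L.length),
    ∃ P a Q, L = P ++ a :: Q ∧ P.sum + P.length ≤ W ∧ W < P.sum + P.length + a + 1 := by
  intro L
  induction L generalizing W with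
  | nil => intro h; simp at h
  | cons x L ih =>
    intro h
    simp only [List.sum_cons, List.length_cons] at h
    by_cases hx : W < x + 1
    · exact ⟨[], x, L, rfl, by simp, by simpa using hx⟩
    · obtain ⟨P, a, Q, h1, h2, h3⟩ := ih (W - (x + 1)) (by omega)
      refine ⟨x :: P, a, Q, by simp [h1], ?_, ?_⟩ <;> simp <;> omega

/-- the selection condition -/
def Sel (q : ℕ) (M : Multiset ℕ) : Prop :=
  (∃ P Q : Multiset ℕ, M = P + Q ∧ Even (P.sum + P.card) ∧ P.sum + P.card ≤ 6 * q ∧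
    Q.sum ≤ max (4 * q) (M.sum - 4 * q)) ∨
  (∃ (P Q : Multiset ℕ) (a b : ℕ), M = P + a ::ₘ Q ∧ 2 ≤ b ∧ b < a ∧
    Even (P.sum + P.card + b + 1) ∧ P.sum + P.card + b + 1 ≤ 6 * q ∧
    Q.sum + (a - b + 1) ≤ max (4 * q) (M.sum - 4 * q))

lemma sel_greedy {q : ℕ} (hq : 3 ≤ q) (hqo : Odd q) (P Q : Multiset ℕ) (a : ℕ)
    (hP2 : ∀ x ∈ P, 2 ≤ x) (ha2 : 2 ≤ a) (hPa : ∀ x ∈ P, a ≤ x)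
    (hQ : ∀ x ∈ Q, 2 ≤ x ∧ x ≤ a) (hn2 : (P + a ::ₘ Q).count 2 < 2 * q)
    (h1 : P.sum + P.card ≤ 6 * q) (h2 : 6 * q < P.sum + P.card + a + 1) :
    Sel q (P + a ::ₘ Q) := by
  have hsum : (P + a ::ₘ Q).sum = P.sum + (a + Q.sum) := by
    rw [Multiset.sum_add, Multiset.sum_cons]
  have c3 := three_card P hP2
  have cP2 : P.card * 2 ≤ P.sum := Multiset.card_nsmul_le_sum hP2
  have c0 : P.count 2 + Q.count 2 < 2 * q := by
    rw [Multiset.count_add] at hn2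
    have := Multiset.count_le_count_cons 2 a Q
    omega
  have hcnt : a = 2 → Q.sum = 2 * Q.card ∧ P.count 2 + Q.card + 1 < 2 * q := by
    rintro rfl
    have hr : Q = Multiset.replicate Q.card 2 :=
      Multiset.eq_replicate_card.2 (fun x hx => by have := hQ x hx; omega)
    have hcc : Q.count 2 = Q.card := by
      conv_lhs => rw [hr]
      simp
    constructor
    · conv_lhs => rw [hr]
      simp [mul_comm]
    · rw [Multiset.count_add, Multiset.count_cons_self, hcc] at hn2
      omega
  have hcnt3 : 3 ≤ a → P.count 2 = 0 := by
    intro h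
    rw [Multiset.count_eq_zero]
    intro h'
    have := hPa 2 h'
    omega
  obtain ⟨t, ht⟩ := hqo
  obtain ⟨e, he⟩ : ∃ e, P.sum + P.card + e = 6 * q := ⟨6 * q - (P.sum + P.card), by omega⟩
  by_cases e0 : e = 0
  · left
    refine ⟨P, a ::ₘ Q, rfl, ⟨3 * q, by omega⟩, by omega, ?_⟩
    rw [hsum, Multiset.sum_cons]
    omega
  by_cases e3 : 3 ≤ e
  · right
    have := hcnt3 (by omega)
    refine ⟨P, Q, a, e - 1, rfl, by omega, by omega, ⟨3 * q, by omega⟩, by omega, ?_⟩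
    rw [hsum]
    omega
  by_cases e2 : e = 2
  · left
    refine ⟨P, a ::ₘ Q, rfl, ⟨3 * q - 1, by omega⟩, by omega, ?_⟩
    rw [hsum, Multiset.sum_cons]
    by_cases h : 3 ≤ a
    · have := hcnt3 h
      omega
    · have := hcnt (by omega)
      omega
  have e1 : e = 1 := by omega
  subst e1
  by_cases hr : P.card ≤ 2 * q - 3
  · right
    obtain ⟨p, hp, hp3⟩ : ∃ p ∈ P, 3 ≤ p := by
      by_contra! hn
      have : P.sum ≤ P.card • 2 := Multiset.sum_le_card_nsmul P 2 (fun x hx => by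
        have := hn x hx; omega)
      rw [smul_eq_mul] at this
      omega
    obtain ⟨P', rfl⟩ := Multiset.exists_cons_of_mem hp
    simp only [Multiset.sum_cons, Multiset.card_cons] at *
    refine ⟨P', a ::ₘ Q, p, p - 1, by
      simp only [Multiset.cons_add, Multiset.add_cons]; exact Multiset.cons_swap _ _ _, by omega, by omega,
      ⟨3 * q - 1, by omega⟩, by omega, ?_⟩
    rw [hsum, Multiset.sum_cons]
    omega
  by_cases h2P : 2 ∈ P
  · have ha : a = 2 := by have := hPa 2 h2P; omega
    have hc := hcnt ha
    have hpos := Multiset.count_pos.2 h2P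
    left
    obtain ⟨P', rfl⟩ := Multiset.exists_cons_of_mem h2P
    simp only [Multiset.sum_cons, Multiset.card_cons] at *
    refine ⟨P', 2 ::ₘ a ::ₘ Q, by
      simp only [Multiset.cons_add, Multiset.add_cons]; exact Multiset.cons_swap _ _ _, ⟨3 * q - 2, by omega⟩,
      by omega, ?_⟩
    rw [hsum, Multiset.sum_cons, Multiset.sum_cons]
    omega
  · have hz := Multiset.count_eq_zero.2 h2P
    have hq3 : q = 3 := by omega
    subst hq3
    left
    have hP3 : ∀ x ∈ P, 3 ≤ x := by
      intro x hx
      have := hP2 x hx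
      have : x ≠ 2 := by rintro rfl; exact h2P hx
      omega
    have ha3 : a ≤ 3 := by
      have : P.card • a ≤ P.sum := Multiset.card_nsmul_le_sum hPa
      rw [smul_eq_mul] at this
      have h4 : P.card = 4 := by omega
      rw [h4] at this
      omega
    by_cases ha : a = 3
    · obtain ⟨p, hp, hp3⟩ : ∃ p ∈ P, 4 ≤ p := by
        by_contra! hn
        have : P.sum ≤ P.card • 3 := Multiset.sum_le_card_nsmul P 3 (fun x hx => by
          have := hn x hx; omega)
        rw [smul_eq_mul] at this
        omega
      obtain ⟨P', rfl⟩ := Multiset.exists_cons_of_mem hp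
      have h5 : P'.card • 3 ≤ P'.sum :=
        Multiset.card_nsmul_le_sum (fun x hx => hP3 x (Multiset.mem_cons_of_mem hx))
      rw [smul_eq_mul] at h5
      simp only [Multiset.sum_cons, Multiset.card_cons] at *
      refine ⟨a ::ₘ P', p ::ₘ Q, by simp [Multiset.cons_swap], ⟨8, ?_⟩, ?_, ?_⟩
      · simp only [Multiset.sum_cons, Multiset.card_cons]; omega
      · simp only [Multiset.sum_cons, Multiset.card_cons]; omega
      · rw [hsum, Multiset.sum_cons]; omega
    · obtain ⟨p, hp, hp3⟩ : ∃ p ∈ P, p ≤ 3 := by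
        by_contra! hn
        have : P.card • 4 ≤ P.sum := Multiset.card_nsmul_le_sum (fun x hx => by
          have := hn x hx; omega)
        rw [smul_eq_mul] at this
        omega
      have := hP3 p hp
      obtain ⟨P', rfl⟩ := Multiset.exists_cons_of_mem hp
      simp only [Multiset.sum_cons, Multiset.card_cons] at *
      refine ⟨a ::ₘ P', p ::ₘ Q, by simp [Multiset.cons_swap], ⟨8, ?_⟩, ?_, ?_⟩
      · simp only [Multiset.sum_cons, Multiset.card_cons]; omega
      · simp only [Multiset.sum_cons, Multiset.card_cons]; omega
      · rw [hsum, Multiset.sum_cons]; omega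

lemma sel {q : ℕ} (hq : 3 ≤ q) (hqo : Odd q) (M : Multiset ℕ) (hM : ∀ x ∈ M, 2 ≤ x)
    (hev : Even (M.sum + M.card)) : Sel q M := by
  by_cases hn : 2 * q ≤ M.count 2
  · left
    obtain ⟨Q, hQ⟩ := Multiset.le_iff_exists_add.1 (Multiset.le_count_iff_replicate_le.1 hn)
    refine ⟨Multiset.replicate (2 * q) 2, Q, hQ, ⟨3 * q, ?_⟩, ?_, ?_⟩
    · simp; omega
    · simp; omega
    · rw [hQ]; simp; omega
  by_cases hw : M.sum + M.card ≤ 6 * q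
  · left
    exact ⟨M, 0, by simp, hev, hw, by simp⟩
  set L := M.sort (· ≥ ·) with hL
  have hLM : (L : Multiset ℕ) = M := Multiset.sort_eq _ _
  have hs : L.Pairwise (· ≥ ·) := Multiset.pairwise_sort M (· ≥ ·)
  obtain ⟨P, a, Q, h1, h2, h3⟩ := exists_split (6 * q) L (by
    rw [← hLM] at hw; simp at hw; omega)
  have hLM' : M = (P : Multiset ℕ) + a ::ₘ (Q : Multiset ℕ) := by
    rw [← hLM, h1]; simp
  rw [h1, List.pairwise_append, List.pairwise_cons] at hs
  rw [hLM'] at hM hn ⊢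
  refine sel_greedy hq hqo _ _ a ?_ ?_ ?_ ?_ (by omega) (by simpa using h2) (by simpa using h3)
  · intro x hx; exact hM x (by simp at hx; simp [hx])
  · exact hM a (by simp)
  · intro x hx; exact hs.2.2 x (by simpa using hx) a (by simp)
  · intro x hx
    have hx' : x ∈ Q := by simpa using hx
    exact ⟨hM x (by simp [hx']), hs.2.1.1 x hx'⟩

lemma peel {q : ℕ} (hq : 3 ≤ q) (hqo : Odd q) {σ : Perm α} (hs : Perm.sign σ = 1) :
    ∃ σ₁ σ₂ : Perm α, σ = σ₂ * σ₁ ∧ Perm.sign σ₂ = 1 ∧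
      σ₂.support.card + σ₂.cycleType.card ≤ 6 * q ∧
      σ₁.support.card ≤ max (4 * q) (σ.support.card - 4 * q) := by
  have hev := (sign_iff σ).1 hs
  rw [← Perm.sum_cycleType] at hev
  rcases sel hq hqo σ.cycleType (fun x hx => Perm.two_le_of_mem_cycleType hx) hev with
    ⟨P, Q, h1, h2, h3, h4⟩ | ⟨P, Q, a, b, h1, h2, h3, h4, h5, h6⟩
  · obtain ⟨σ₂, σ₁, -, e, c2, c1⟩ := split_ct P Q σ h1
    refine ⟨σ₁, σ₂, e, ?_, ?_, ?_⟩
    · rw [sign_iff, ← Perm.sum_cycleType, c2]; exact h2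
    · rw [← Perm.sum_cycleType, c2]; exact h3
    · rw [← Perm.sum_cycleType, c1, ← Perm.sum_cycleType]; exact h4
  · obtain ⟨σ₂, ρ, d, e, c2, c1⟩ := split_ct P _ σ h1
    obtain ⟨c, σ₁, f1, f2, f3, f4, f5⟩ := extract (σ := ρ) (a := a) (by rw [c1]; simp)
    rw [c1, Multiset.cons_inj_right] at f5
    obtain ⟨A, B, g1, g2, g3, g4, g5⟩ := cut f1 h2 (by omega)
    have d' := d.disjoint_support
    rw [f4, f3.support_mul, Finset.disjoint_union_right] at d'
    have dA : σ₂.Disjoint A := Perm.disjoint_iff_disjoint_support.2 (d'.1.mono_right g4)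
    have hct : (σ₂ * A).cycleType = P + {b} := by
      rw [dA.cycleType_mul, c2, g2.cycleType, g3]
    refine ⟨B * σ₁, σ₂ * A, by rw [e, f4, g1]; group, ?_, ?_, ?_⟩
    · rw [sign_iff, ← Perm.sum_cycleType, hct]
      convert h4 using 1; simp; omega
    · rw [← Perm.sum_cycleType, hct]
      simp; omega
    · have k1 : (B * σ₁).support.card ≤ B.support.card + σ₁.support.card :=
        (Finset.card_le_card (Perm.support_mul_le B σ₁)).trans (Finset.card_union_le _ _)
      have k2 : σ₁.support.card = Q.sum := by rw [← Perm.sum_cycleType, f5]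
      rw [Perm.sum_cycleType] at h6
      omega

lemma main_lower {q : ℕ} (hq : 3 ≤ q) (hqo : Odd q) (hα : 6 * q ≤ Fintype.card α) (k : ℕ) :
    2 ≤ k → 2 * k * q ≤ Fintype.card α → ∀ σ : Perm α, Perm.sign σ = 1 →
    σ.support.card ≤ 2 * k * q → IsP (3 * q) k σ := by
  induction k using Nat.strong_induction_on with
  | _ k ih =>
    intro hk hkα σ hs hm
    have h3 := two_card σ
    by_cases k2 : k = 2
    · subst k2
      exact two_lemma (by omega) hs (by omega) (by omega)
    by_cases k3 : k = 3
    · subst k3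
      exact three_lemma (by omega) hqo hs hα (by omega)
    obtain ⟨j, rfl⟩ : ∃ j, k = 2 + j := ⟨k - 2, by omega⟩
    have ej : 2 * (2 + j) * q = 4 * q + 2 * j * q := by ring
    have ej2 : 4 * q ≤ 2 * j * q := Nat.mul_le_mul_right q (by omega)
    obtain ⟨σ₁, σ₂, e, s2, w2, m1⟩ := peel hq hqo hs
    have s1 : Perm.sign σ₁ = 1 := by
      have := congrArg Perm.sign e
      rwa [hs, map_mul, s2, one_mul, eq_comm] at this
    rw [e]
    refine (two_lemma (by omega) s2 (by omega) ?_).mul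
      (ih j (by omega) (by omega) (by omega) σ₁ s1 ?_)
    · omega
    · omega

lemma lower {q k : ℕ} (hq : 3 ≤ q) (hqo : Odd q) (hk : 2 ≤ k) (hα : Fintype.card α = 2 * k * q)
    (σ : Perm α) (hs : Perm.sign σ = 1) : IsP (3 * q) k σ := by
  by_cases k2 : k = 2
  · subst k2
    exact two_full (by omega) hs (by omega)
  · have : 2 * 3 * q ≤ 2 * k * q := Nat.mul_le_mul_right q (by omega)
    exact main_lower hq hqo (by omega) k hk hα.ge σ hs (hα ▸ Finset.card_le_univ _)

end NKL

lemma isP_fn {n k l : ℕ} {σ : Equiv.Perm (Fin n)} (h : NKL.IsP l k σ) :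
    IsProdOfCycles n k l σ := by
  obtain ⟨L, rfl, h2, h3⟩ := h
  exact ⟨L.get, fun i => h2 _ (List.get_mem L i), by rw [List.ofFn_get]; exact h3⟩

theorem n_k_l_bounds_l_odd (k l : ℕ) (hk : 2 ≤ k) (hl3 : 3 ∣ l) (hl : 9 ≤ l)
    (hlo : Odd l) :
    (∀ σ ∈ alternatingGroup (Fin (2 * k * l / 3)),
      IsProdOfCycles (2 * k * l / 3) k l σ) ∧
    (∀ n : ℕ, 2 * k * l / 3 + 1 < n →
      ∃ σ ∈ alternatingGroup (Fin n), ¬ IsProdOfCycles n k l σ) ∧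
    (Odd k → ∃ σ ∈ alternatingGroup (Fin (2 * k * l / 3 + 1)),
      ¬ IsProdOfCycles (2 * k * l / 3 + 1) k l σ) := by
  obtain ⟨q, rfl⟩ := hl3
  have hq : 3 ≤ q := by omega
  have hqo : Odd q := (Nat.odd_mul.1 hlo).2
  have e : 2 * k * (3 * q) / 3 = 2 * k * q := by
    rw [show 2 * k * (3 * q) = 2 * k * q * 3 by ring]
    exact Nat.mul_div_cancel _ (by norm_num)
  rw [e]
  have up : ∀ n, (2 * k * q + 1 < n ∨ (Odd k ∧ n = 2 * k * q + 1)) →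
      ∃ σ ∈ alternatingGroup (Fin n), ¬ IsProdOfCycles n k (3 * q) σ := by
    intro n hn
    obtain ⟨σ, h1, h2⟩ := NKL.upper_main n k q hk hq hqo hn
    refine ⟨σ, h1, ?_⟩
    rintro ⟨c, hc, h⟩
    refine h2 (List.ofFn c) (by simp) ?_ h
    intro d hd
    obtain ⟨i, rfl⟩ := (List.mem_ofFn' c d).1 hd
    exact hc i
  refine ⟨?_, fun n hn => up n (Or.inl hn), fun ho => up _ (Or.inr ⟨ho, rfl⟩)⟩
  intro σ hσ
  exact isP_fn (NKL.lower hq hqo hk (by simp) σ (Equiv.Perm.mem_alternatingGroup.1 hσ))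
end

section
/- Let k, l, n be natural numbers such that k ≥ 2, l is odd, and 9 ≤ l ≤ n ≤ (2/3)kl + 1 (i.e., 3(n−1) ≤ 2kl). Let σ ∈ A_n be such that, in case k ≥ 3, the number n_σ of cycles in the disjoint cycle decomposition of σ satisfies 3·n_σ ≤ n + 2. Then σ can be written as a product of k many l-cycles of S_n. -/
open Equiv

section helpers

variable {α : Type*} [DecidableEq α]

lemma fp_split (xs ys : List α) (x : α) :
    (xs ++ x :: ys).formPerm = (xs ++ [x]).formPerm * (x :: ys).formPerm := by
  induction xs with
  | nil => simp
  | cons a t ih =>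
    cases t with
    | nil => simp [List.formPerm_cons_cons]
    | cons b t =>
      simp only [List.cons_append, List.formPerm_cons_cons] at ih ⊢
      rw [ih, mul_assoc]

lemma fp_join (xs ys : List α) (x y : α) :
    (xs ++ x :: y :: ys).formPerm
      = (xs ++ [x]).formPerm * swap x y * (y :: ys).formPerm := by
  rw [fp_split, List.formPerm_cons_cons, mul_assoc]

lemma fp_mul_swap_mul (a b : List α) (ha : a.Nodup) (hb : b.Nodup)
    {x y : α} (hx : x ∈ a) (hy : y ∈ b) :
    ∃ c : List α, c.Perm (a ++ b) ∧ c.formPerm = a.formPerm * swap x y * b.formPerm := by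
  obtain ⟨s, t, rfl⟩ := List.append_of_mem hx
  obtain ⟨u, v, rfl⟩ := List.append_of_mem hy
  have h1 : (s ++ x :: t) ~r (t ++ s ++ [x]) := by
    have : (s ++ [x]) ++ t ~r t ++ (s ++ [x]) := List.isRotated_append
    simpa using this
  have h2 : (u ++ y :: v) ~r (y :: (v ++ u)) := by
    have : u ++ (y :: v) ~r (y :: v) ++ u := List.isRotated_append
    simpa using this
  refine ⟨(t ++ s) ++ x :: y :: (v ++ u), ?_, ?_⟩
  · have h3 := (h1.perm.append h2.perm).symm
    simpa using h3
  · rw [fp_join, ← List.formPerm_eq_of_isRotated ha h1, ← List.formPerm_eq_of_isRotated hb h2]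

lemma fp_disj (a b : List α) (h : a.Disjoint b) : a.formPerm.Disjoint b.formPerm := by
  intro x
  by_cases hx : x ∈ a
  · right; exact List.formPerm_apply_of_notMem (fun hb => h hx hb)
  · left; exact List.formPerm_apply_of_notMem hx

lemma fp_mem (b : List α) {y : α} (hy : y ∈ b) : b.formPerm y ∈ b := by
  exact List.formPerm_apply_mem_of_mem hy

lemma fp_inv_mem (b : List α) {y : α} (hy : y ∈ b) : b.formPerm⁻¹ y ∈ b := by
  by_contra h
  have h1 := List.formPerm_apply_of_notMem h
  rw [← h1, ← Equiv.Perm.mul_apply, mul_inv_cancel] at h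
  exact h hy

lemma fp_mul_swap (a b : List α) (ha : a.Nodup) (hb : b.Nodup) (hd : a.Disjoint b)
    {x y : α} (hx : x ∈ a) (hy : y ∈ b) :
    ∃ c : List α, c.Perm (a ++ b) ∧ c.formPerm = a.formPerm * b.formPerm * swap x y := by
  obtain ⟨c, h1, h2⟩ := fp_mul_swap_mul a b ha hb hx (fp_mem b hy)
  refine ⟨c, h1, ?_⟩
  rw [h2, mul_assoc, mul_assoc, mul_swap_eq_swap_mul b.formPerm,
    List.formPerm_apply_of_notMem (l := b) (x := x) (fun h => hd hx h)]

lemma fp_swap_mul (a b : List α) (ha : a.Nodup) (hb : b.Nodup) (hd : a.Disjoint b)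
    {x y : α} (hx : x ∈ a) (hy : y ∈ b) :
    ∃ c : List α, c.Perm (a ++ b) ∧ c.formPerm = swap x y * a.formPerm * b.formPerm := by
  obtain ⟨c, h1, h2⟩ := fp_mul_swap_mul a b ha hb (fp_inv_mem a hx) hy
  refine ⟨c, h1, ?_⟩
  have : a.formPerm⁻¹ y = y := by
    rw [Equiv.Perm.inv_eq_iff_eq]
    exact (List.formPerm_apply_of_notMem (fun h => hd h hy)).symm
  rw [h2, swap_mul_eq_mul_swap a.formPerm, this]

variable [Fintype α]

lemma two_m_le (σ : Perm α) : 2 * σ.cycleType.card ≤ σ.cycleType.sum := by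
  have := Multiset.card_nsmul_le_sum (s := σ.cycleType) (a := 2)
    (fun x hx => Equiv.Perm.two_le_of_mem_cycleType hx)
  simpa [mul_comm] using this

/-- Key lemma: a permutation is a product of two cycles of prescribed lengths. -/
lemma key (σ : Perm α) : ∀ a b : ℕ,
    a + b = σ.cycleType.sum + σ.cycleType.card → σ.cycleType.card ≤ a → σ.cycleType.card ≤ b →
    ∃ l1 l2 : List α, l1.Nodup ∧ l2.Nodup ∧ l1.length = a ∧ l2.length = b ∧
      (∀ x ∈ l1, x ∈ σ.support) ∧ (∀ x ∈ l2, x ∈ σ.support) ∧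
      (σ = 1 ∨ ∃ x, x ∈ l1 ∧ x ∈ l2) ∧ σ = l1.formPerm * l2.formPerm := by
  induction σ using Equiv.Perm.cycle_induction_on with
  | base_one =>
    intro a b h _ _
    simp at h
    exact ⟨[], [], by simp [h.1, h.2]⟩
  | base_cycles σ hσ =>
    intro a b h ha hb
    rw [hσ.cycleType] at h ha hb
    simp at h ha hb
    obtain ⟨x, hx, -⟩ := id hσ
    have hf := Equiv.Perm.formPerm_toList σ x
    rw [hσ.cycleOf_eq hx] at hf
    have hlen := Equiv.Perm.length_toList σ x
    rw [hσ.cycleOf_eq hx] at hlen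
    have hnd := Equiv.Perm.nodup_toList σ x
    have hmem : ∀ y ∈ σ.toList x, y ∈ σ.support := by
      intro y hy
      rw [Equiv.Perm.mem_toList_iff] at hy
      exact (hy.1.mem_support_iff).1 hy.2
    generalize σ.toList x = T at *
    have hT : T = T.take (a-1) ++ T.drop (a-1) := (List.take_append_drop _ _).symm
    have hl1 : (T.take (a-1)).length = a - 1 := by simp; omega
    have hl2 : (T.drop (a-1)).length = b := by simp; omega
    generalize T.take (a-1) = u at *
    generalize T.drop (a-1) = v at *
    cases v with
    | nil => simp at hl2; omega
    | cons z v =>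
      subst hT
      refine ⟨u ++ [z], z :: v, ?_, ?_, ?_, ?_, ?_, ?_, ?_, ?_⟩
      · refine hnd.sublist ?_
        simp
      · exact hnd.sublist (by simp)
      · simp; omega
      · simpa using hl2
      · intro y hy; apply hmem; simp at hy ⊢; tauto
      · intro y hy; apply hmem; simp at hy ⊢; tauto
      · right; exact ⟨z, by simp, by simp⟩
      · rw [← hf, fp_split]
  | induction_disjoint σ τ hd hσ ih1 ih2 =>
    intro a b h ha hb
    rw [hd.cycleType_mul] at h ha hb
    simp only [Multiset.sum_add, Multiset.card_add] at h ha hb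
    have e1 := two_m_le σ
    have e2 := two_m_le τ
    by_cases hτ : τ = 1
    · subst hτ
      simp at h ha hb
      simpa using ih1 a b h ha hb
    generalize σ.cycleType.sum = s1 at *
    generalize σ.cycleType.card = m1 at *
    generalize τ.cycleType.sum = s2 at *
    generalize τ.cycleType.card = m2 at *
    obtain ⟨a1, a2, b1, b2, h1, h2, h3, h4, h5, h6, h7, h8⟩ : ∃ a1 a2 b1 b2 : ℕ,
        a1 + b1 = s1 + m1 ∧ a2 + b2 = s2 + m2 ∧ m1 ≤ a1 ∧ m1 ≤ b1 ∧ m2 ≤ a2 ∧ m2 ≤ b2 ∧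
        a1 + a2 = a ∧ b1 + b2 = b := by
      by_cases hc : a - m2 ≤ s1
      · exact ⟨a - m2, m2, s1 + m1 - (a - m2), s2, by omega, by omega, by omega, by omega,
          by omega, by omega, by omega, by omega⟩
      · exact ⟨s1, a - s1, m1, s2 + m2 - (a - s1), by omega, by omega, by omega, by omega,
          by omega, by omega, by omega, by omega⟩
    obtain ⟨p1, q1, np1, nq1, lp1, lq1, sp1, sq1, c1, f1⟩ := ih1 a1 b1 h1 h3 h4
    obtain ⟨p2, q2, np2, nq2, lp2, lq2, sp2, sq2, c2, f2⟩ := ih2 a2 b2 h2 h5 h6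
    obtain ⟨x, hx1, hx2⟩ := c1.resolve_left hσ.ne_one
    obtain ⟨y, hy1, hy2⟩ := c2.resolve_left hτ
    have dj : ∀ z, z ∈ σ.support → z ∈ τ.support → False := fun z h1 h2 =>
      Finset.disjoint_left.1 hd.disjoint_support h1 h2
    have dpp : p1.Disjoint p2 := fun z h1 h2 => dj z (sp1 z h1) (sp2 z h2)
    have dqq : q1.Disjoint q2 := fun z h1 h2 => dj z (sq1 z h1) (sq2 z h2)
    have dqp : q1.Disjoint p2 := fun z h1 h2 => dj z (sq1 z h1) (sp2 z h2)
    obtain ⟨P, hP1, hP2⟩ := fp_mul_swap p1 p2 np1 np2 dpp hx1 hy1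
    obtain ⟨Q, hQ1, hQ2⟩ := fp_swap_mul q1 q2 nq1 nq2 dqq hx2 hy2
    refine ⟨P, Q, ?_, ?_, ?_, ?_, ?_, ?_, ?_, ?_⟩
    · exact hP1.nodup_iff.2 (List.nodup_append'.2 ⟨np1, np2, dpp⟩)
    · exact hQ1.nodup_iff.2 (List.nodup_append'.2 ⟨nq1, nq2, dqq⟩)
    · rw [hP1.length_eq]; simp; omega
    · rw [hQ1.length_eq]; simp; omega
    · intro z hz
      rw [hd.support_mul]
      have := hP1.mem_iff.1 hz
      simp only [List.mem_append, Finset.mem_union] at this ⊢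
      exact this.imp (sp1 z) (sp2 z)
    · intro z hz
      rw [hd.support_mul]
      have := hQ1.mem_iff.1 hz
      simp only [List.mem_append, Finset.mem_union] at this ⊢
      exact this.imp (sq1 z) (sq2 z)
    · right
      exact ⟨x, hP1.mem_iff.2 (by simp [hx1]), hQ1.mem_iff.2 (by simp [hx2])⟩
    · have hc := (fp_disj _ _ dqp).commute
      rw [hP2, hQ2]
      nth_rewrite 1 [f1]
      nth_rewrite 1 [f2]
      calc _ = p1.formPerm * (q1.formPerm * p2.formPerm) * q2.formPerm := by group
        _ = p1.formPerm * (p2.formPerm * q1.formPerm) * q2.formPerm := by rw [hc.eq]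
        _ = p1.formPerm * p2.formPerm * (swap x y * swap x y) * q1.formPerm * q2.formPerm := by
          rw [Equiv.swap_mul_self]; group
        _ = _ := by group

/-- raising the lengths -/
lemma raise (l : ℕ) (hl : 1 ≤ l) (hln : l < Fintype.card α) (p q : List α)
    (hp : p.Nodup) (hq : q.Nodup) (lp : p.length = l) (lq : q.length = l) :
    ∃ p' q' : List α, p'.Nodup ∧ q'.Nodup ∧ p'.length = l + 1 ∧ q'.length = l + 1 ∧
      p.formPerm * q.formPerm = p'.formPerm * q'.formPerm := by
  have cp : p.toFinset.card = l := by rw [List.toFinset_card_of_nodup hp, lp]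
  have cq : q.toFinset.card = l := by rw [List.toFinset_card_of_nodup hq, lq]
  have key2 : ∃ x y : α, ((x ∈ p ∧ y ∉ p) ∨ (y ∈ p ∧ x ∉ p)) ∧ (x ∈ q ∧ y ∉ q) := by
    by_cases hs : p.toFinset = q.toFinset
    · have hne : p.toFinset.Nonempty := by rw [← Finset.card_pos]; omega
      obtain ⟨x, hx⟩ := hne
      have : ∃ y, y ∉ p.toFinset := by
        by_contra hcon
        push Not at hcon
        have : p.toFinset = Finset.univ := Finset.eq_univ_of_forall hcon
        rw [this, Finset.card_univ] at cp
        omega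
      obtain ⟨y, hy⟩ := this
      have hx' := hx
      have hy' := hy
      rw [hs] at hx' hy'
      simp only [List.mem_toFinset] at *
      exact ⟨x, y, Or.inl ⟨hx, hy⟩, hx', hy'⟩
    · have h1 : ¬ p.toFinset ⊆ q.toFinset := fun h => hs (Finset.eq_of_subset_of_card_le h (by omega))
      have h2 : ¬ q.toFinset ⊆ p.toFinset := fun h =>
        hs (Finset.eq_of_subset_of_card_le h (by omega)).symm
      obtain ⟨y, hy1, hy2⟩ := Finset.not_subset.1 h1
      obtain ⟨x, hx1, hx2⟩ := Finset.not_subset.1 h2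
      simp only [List.mem_toFinset] at *
      exact ⟨x, y, Or.inr ⟨hy1, hx2⟩, hx1, hy2⟩
  obtain ⟨x, y, h1, hxq, hyq⟩ := key2
  have P : ∃ p' : List α, p'.Nodup ∧ p'.length = l + 1 ∧ p'.formPerm = p.formPerm * swap x y := by
    rcases h1 with ⟨h1, h2⟩ | ⟨h1, h2⟩
    · have hd : p.Disjoint [y] := by simpa using h2
      obtain ⟨c, hc, hc2⟩ := fp_mul_swap p [y] hp (by simp) hd h1 (by simp : y ∈ [y])
      exact ⟨c, hc.nodup_iff.2 (List.nodup_append'.2 ⟨hp, by simp, hd⟩),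
        by rw [hc.length_eq]; simp [lp], by simpa using hc2⟩
    · have hd : p.Disjoint [x] := by simpa using h2
      obtain ⟨c, hc, hc2⟩ := fp_mul_swap p [x] hp (by simp) hd h1 (by simp : x ∈ [x])
      exact ⟨c, hc.nodup_iff.2 (List.nodup_append'.2 ⟨hp, by simp, hd⟩),
        by rw [hc.length_eq]; simp [lp], by rw [swap_comm x y]; simpa using hc2⟩
  have Q : ∃ q' : List α, q'.Nodup ∧ q'.length = l + 1 ∧ q'.formPerm = swap x y * q.formPerm := by
    have hd : q.Disjoint [y] := by simpa using hyq
    obtain ⟨c, hc, hc2⟩ := fp_swap_mul q [y] hq (by simp) hd hxq (by simp : y ∈ [y])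
    exact ⟨c, hc.nodup_iff.2 (List.nodup_append'.2 ⟨hq, by simp, hd⟩),
        by rw [hc.length_eq]; simp [lq], by simpa using hc2⟩
  obtain ⟨p', a1, a2, a3⟩ := P
  obtain ⟨q', b1, b2, b3⟩ := Q
  refine ⟨p', q', a1, b1, a2, b2, ?_⟩
  rw [a3, b3]
  calc _ = p.formPerm * (swap x y * swap x y) * q.formPerm := by rw [Equiv.swap_mul_self]; group
    _ = _ := by group

lemma raise_to (l : ℕ) (hl : 1 ≤ l) (d : ℕ) : ∀ (_ : l + d ≤ Fintype.card α) (p q : List α)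
    (_ : p.Nodup) (_ : q.Nodup) (_ : p.length = l) (_ : q.length = l),
    ∃ p' q' : List α, p'.Nodup ∧ q'.Nodup ∧ p'.length = l + d ∧ q'.length = l + d ∧
      p.formPerm * q.formPerm = p'.formPerm * q'.formPerm := by
  induction d with
  | zero => intro _ p q hp hq lp lq; exact ⟨p, q, hp, hq, lp, lq, rfl⟩
  | succ d ih =>
    intro h p q hp hq lp lq
    obtain ⟨p1, q1, a1, a2, a3, a4, a5⟩ := ih (by omega) p q hp hq lp lq
    obtain ⟨p2, q2, b1, b2, b3, b4, b5⟩ := raise (l + d) (by omega) (by omega) p1 q1 a1 a2 a3 a4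
    exact ⟨p2, q2, b1, b2, b3, b4, a5.trans b5⟩

/-- list version of being a product of `k` many `l`-cycles -/
def PR (k l : ℕ) (σ : Perm α) : Prop :=
  ∃ L : List (Perm α), L.length = k ∧ (∀ c ∈ L, c.IsCycle ∧ c.support.card = l) ∧ σ = L.prod

lemma fp_cyc (p : List α) (hp : p.Nodup) (h2 : 2 ≤ p.length) :
    p.formPerm.IsCycle ∧ p.formPerm.support.card = p.length := by
  refine ⟨List.isCycle_formPerm hp h2, ?_⟩
  rw [List.support_formPerm_of_nodup p hp, List.toFinset_card_of_nodup hp]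
  rintro x rfl
  simp at h2

lemma PR.mul {k j l : ℕ} {σ τ : Perm α} (h1 : PR k l σ) (h2 : PR j l τ) :
    PR (k + j) l (σ * τ) := by
  obtain ⟨A, a1, a2, a3⟩ := h1
  obtain ⟨B, b1, b2, b3⟩ := h2
  refine ⟨A ++ B, by simp [a1, b1], ?_, by simp [a3, b3]⟩
  intro c hc
  rcases List.mem_append.1 hc with h | h
  · exact a2 c h
  · exact b2 c h

lemma PR.one {l : ℕ} {c : Perm α} (h : c.IsCycle) (h2 : c.support.card = l) : PR 1 l c :=
  ⟨[c], rfl, by simp [h, h2], by simp⟩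

lemma PR.succ {k l : ℕ} {σ : Perm α} (hlo : Odd l) (hk : 1 ≤ k) (h1 : PR k l σ) :
    PR (k + 1) l σ := by
  obtain ⟨A, a1, a2, a3⟩ := h1
  cases A with
  | nil => simp at a1; omega
  | cons c A =>
    have hc := a2 c (by simp)
    have hco : Nat.Coprime 2 (orderOf c) := by
      rw [hc.1.orderOf, hc.2]
      exact (Nat.coprime_two_left).2 hlo
    refine ⟨c ^ 2 :: c⁻¹ :: A, by simpa using a1, ?_, ?_⟩
    · intro d hd
      simp only [List.mem_cons] at hd
      rcases hd with rfl | rfl | hd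
      · exact ⟨hc.1.pow_iff.2 hco, by rw [Equiv.Perm.support_pow_coprime hco]; exact hc.2⟩
      · exact ⟨hc.1.inv, by rw [Equiv.Perm.support_inv]; exact hc.2⟩
      · exact a2 d (by simp [hd])
    · rw [a3]; simp [pow_two]

lemma even_w (σ : Perm α) (h : Perm.sign σ = 1) :
    Even (σ.cycleType.sum + σ.cycleType.card) := by
  rw [Equiv.Perm.sign_of_cycleType] at h
  rcases Nat.even_or_odd (σ.cycleType.sum + σ.cycleType.card) with h' | h'
  · exact h'
  · rw [h'.neg_one_pow] at h
    exact absurd h (by decide)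

lemma base_two (l : ℕ) (hl : 2 ≤ l) (hln : l ≤ Fintype.card α) (σ : Perm α)
    (hs : Perm.sign σ = 1) (hw : σ.cycleType.sum + σ.cycleType.card ≤ 2 * l) : PR 2 l σ := by
  have main : ∃ p q : List α, p.Nodup ∧ q.Nodup ∧ p.length = l ∧ q.length = l ∧
      σ = p.formPerm * q.formPerm := by
    by_cases h1 : σ = 1
    · obtain ⟨s, -, hs2⟩ := Finset.exists_subset_card_eq (s := (Finset.univ : Finset α)) (n := l)
        (by simpa using hln)
      refine ⟨s.toList, s.toList.reverse, s.nodup_toList, List.nodup_reverse.2 s.nodup_toList,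
        by simp [hs2], by simp [hs2], ?_⟩
      rw [List.formPerm_reverse, h1]; simp
    · obtain ⟨L, hL⟩ := even_w σ hs
      have e1 := two_m_le σ
      have hpos : 0 < σ.cycleType.card := Equiv.Perm.card_cycleType_pos.2 h1
      obtain ⟨p, q, np, nq, lp, lq, -, -, -, f⟩ := key σ L L hL.symm (by omega) (by omega)
      obtain ⟨p', q', a1, a2, a3, a4, a5⟩ :=
        raise_to L (by omega) (l - L) (by omega) p q np nq lp lq
      exact ⟨p', q', a1, a2, by omega, by omega, f.trans a5⟩
  obtain ⟨p, q, np, nq, lp, lq, rfl⟩ := main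
  have c1 := fp_cyc p np (by omega)
  have c2 := fp_cyc q nq (by omega)
  exact (PR.one c1.1 (c1.2.trans lp)).mul (PR.one c2.1 (c2.2.trans lq))

lemma sign_fp (p : List α) (hp : p.Nodup) (h2 : 2 ≤ p.length) (ho : Odd p.length) :
    Perm.sign p.formPerm = 1 := by
  have c := fp_cyc p hp h2
  rw [c.1.sign, c.2, ho.neg_one_pow]; simp

lemma general (t : ℕ) (ht : 1 ≤ t) (hln : 2 * t + 1 ≤ Fintype.card α) : ∀ k : ℕ, 2 ≤ k →
    ∀ σ : Perm α, Perm.sign σ = 1 →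
    σ.cycleType.sum + σ.cycleType.card ≤ k * (2 * t) + 2 → PR k (2 * t + 1) σ := by
  intro k
  induction k using Nat.strong_induction_on with
  | _ k ih =>
    intro hk σ hs hw
    rcases Nat.lt_or_ge k 3 with h3 | h3
    · obtain rfl : k = 2 := by omega
      exact base_two _ (by omega) hln σ hs (by omega)
    by_cases hsm : σ.cycleType.sum + σ.cycleType.card ≤ (k - 1) * (2 * t) + 2
    · have := (ih (k-1) (by omega) (by omega) σ hs hsm).succ ⟨t, rfl⟩ (by omega)
      rwa [Nat.sub_add_cancel (by omega)] at this
    have e1 := two_m_le σ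
    obtain ⟨L, hL⟩ := even_w σ hs
    obtain ⟨j, i, hj, hi, hki, hj3, hj4⟩ : ∃ j i : ℕ, 1 ≤ j ∧ 2 ≤ i ∧ k = j + i ∧ k ≤ 3 * j ∧
        3 * j ≤ 2 * (k - 1) := ⟨k / 2, k - k / 2, by omega, by omega, by omega, by omega, by omega⟩
    have m1 := Nat.mul_le_mul_right t hj3
    have m2 := Nat.mul_le_mul_right t hj4
    have m3 := Nat.mul_le_mul_right t hj
    have m4 : k * t = j * t + i * t := by rw [hki]; ring
    have m5 := Nat.mul_le_mul_right t hi
    have r1 : k * (2 * t) = 2 * (k * t) := by ring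
    have r2 : (k - 1) * (2 * t) = 2 * ((k - 1) * t) := by ring
    have r3 : 3 * j * t = 3 * (j * t) := by ring
    have r4 : 2 * (k - 1) * t = 2 * ((k - 1) * t) := by ring
    have r5 : (k - 1) * t + t = k * t := by
      obtain ⟨k', rfl⟩ : ∃ k', k = k' + 1 := ⟨k - 1, by omega⟩
      simp; ring
    rw [r1] at hw
    rw [r2] at hsm
    obtain ⟨p, q, np, nq, lp, lq, -, -, -, f⟩ := key σ (2 * (j * t) + 1)
      (L + L - (2 * (j * t) + 1)) (by omega) (by omega) (by omega)
    have c1 := fp_cyc p np (by omega)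
    have c2 := fp_cyc q nq (by omega)
    have s1 := sign_fp p np (by omega) ⟨j * t, lp⟩
    have s2 := sign_fp q nq (by omega) ⟨L - (j * t) - 1, by omega⟩
    have P1 : PR j (2 * t + 1) p.formPerm := by
      rcases Nat.lt_or_ge j 2 with h | h
      · obtain rfl : j = 1 := by omega
        exact PR.one c1.1 (by rw [c1.2, lp]; ring)
      · refine ih j (by omega) h _ s1 ?_
        rw [c1.1.cycleType, c1.2, lp]
        simp
        nlinarith
    have P2 : PR i (2 * t + 1) q.formPerm := by
      refine ih i (by omega) hi _ s2 ?_
      rw [c2.1.cycleType, c2.2, lq]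
      have r6 : i * (2 * t) = 2 * (i * t) := by ring
      simp
      omega
    rw [f, hki]
    exact P1.mul P2

end helpers

theorem auxiliary_hgl (k l n : ℕ) (hk : 2 ≤ k) (hlo : Odd l) (hl : 9 ≤ l)
    (hln : l ≤ n) (hn : 3 * (n - 1) ≤ 2 * k * l)
    (σ : Equiv.Perm (Fin n)) (hσ : σ ∈ alternatingGroup (Fin n))
    (hns : 3 ≤ k → 3 * σ.cycleFactorsFinset.card ≤ n + 2) :
    IsProdOfCycles n k l σ := by
  have hs : Perm.sign σ = 1 := Equiv.Perm.mem_alternatingGroup.1 hσ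
  obtain ⟨t, rfl⟩ := hlo
  have e1 := two_m_le σ
  have e2 : σ.cycleType.sum ≤ n := by
    rw [Equiv.Perm.sum_cycleType]
    simpa using σ.support.card_le_univ
  have e3 : σ.cycleFactorsFinset.card = σ.cycleType.card := by
    rw [Equiv.Perm.cycleType_def]; simp
  rw [e3] at hns
  obtain ⟨L, hL⟩ := even_w σ hs
  have hw : σ.cycleType.sum + σ.cycleType.card ≤ k * (2 * t) + 2 := by
    rcases Nat.lt_or_ge k 3 with h3 | h3
    · obtain rfl : k = 2 := by omega
      omega
    · have h5 := hns h3
      have h6 : 2 * k * (2 * t + 1) = 4 * (k * t) + 2 * k := by ring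
      have h7 : k * (2 * t) = 2 * (k * t) := by ring
      have h8 : k * 4 ≤ k * t := Nat.mul_le_mul_left k (by omega)
      omega
  obtain ⟨A, a1, a2, a3⟩ := general t (by omega) (by simpa using hln) k hk σ hs hw
  subst a1
  refine ⟨fun i => A.get i, fun i => a2 _ (List.get_mem _ _), ?_⟩
  rw [a3]
  congr 1
  exact (List.ofFn_get A).symm
end

section
/- Let k, l, n be natural numbers such that k ≥ 2 is even, 3 divides l, l is even, and 12 ≤ l ≤ n ≤ (2/3)kl + 1. Let σ ∈ A_n be such that 3·n_σ ≤ n + 2. Then σ can be written as a product of k many l-cycles of S_n. -/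
open Equiv

section helpers
set_option linter.unusedSectionVars false
variable {X : Type*} [DecidableEq X]

lemma fp_join_s14 (u v : List X) (x : X) :
    (u ++ [x]).formPerm * (x :: v).formPerm = (u ++ x :: v).formPerm := by
  induction u with
  | nil => simp
  | cons z u ih =>
    cases u with
    | nil => simp [List.formPerm_cons_cons]
    | cons w u =>
      simp only [List.cons_append, List.formPerm_cons_cons] at ih ⊢
      rw [mul_assoc, ih]

lemma fp_rot1 (x : X) (u : List X) (h : (x :: u).Nodup) :
    (x :: u).formPerm = (u ++ [x]).formPerm := by
  have := List.formPerm_rotate_one (x :: u) h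
  simpa using this.symm

lemma fp_two (u w : List X) (x a : X) (h : (x :: (u ++ a :: w)).Nodup) :
    (x :: (u ++ [a])).formPerm * ((a :: w) ++ [x]).formPerm = (u ++ a :: w).formPerm := by
  have h1 : (x :: (u ++ [a])).Nodup := h.sublist (by simp)
  have h2 : (x :: (a :: w)).Nodup := h.sublist (by simp)
  rw [fp_rot1 _ _ h1, ← fp_rot1 _ _ h2, List.formPerm_cons_cons]
  have : (u ++ [a] ++ [x]).formPerm = (u ++ [a]).formPerm * Equiv.swap a x := by
    have := fp_join_s14 u [x] a
    simpa using this.symm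
  rw [this, mul_assoc, ← mul_assoc (Equiv.swap a x), Equiv.swap_comm a x, Equiv.swap_mul_self,
    one_mul, fp_join_s14]

def Cyc (α : Equiv.Perm X) (A : Finset X) : Prop :=
  ∃ L : List X, L.Nodup ∧ L.toFinset = A ∧ L.formPerm = α

lemma Cyc.right {α : Equiv.Perm X} {A : Finset X} (h : Cyc α A) {x : X} (hx : x ∈ A)
    {u : List X} (hu : u.Nodup) (hd : ∀ y ∈ u, y ∉ A) :
    Cyc (α * (x :: u).formPerm) (A ∪ u.toFinset) := by
  obtain ⟨L, hL, rfl, rfl⟩ := h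
  obtain ⟨s, t, rfl⟩ := List.append_of_mem (List.mem_toFinset.1 hx)
  have hr : (s ++ x :: t) ~r (t ++ s ++ [x]) := by
    have : (s ++ [x]) ++ t ~r t ++ (s ++ [x]) := ⟨_, List.rotate_append_length_eq _ _⟩
    simpa using this
  refine ⟨t ++ s ++ x :: u, ?_, ?_, ?_⟩
  · simp only [List.mem_toFinset] at hd
    grind
  · ext y; simp; tauto
  · rw [← fp_join_s14, List.formPerm_eq_of_isRotated hL hr]

lemma Cyc.left {α : Equiv.Perm X} {A : Finset X} (h : Cyc α A) {x : X} (hx : x ∈ A)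
    {u : List X} (hu : u.Nodup) (hd : ∀ y ∈ u, y ∉ A) :
    Cyc ((u ++ [x]).formPerm * α) (A ∪ u.toFinset) := by
  obtain ⟨L, hL, rfl, rfl⟩ := h
  obtain ⟨s, t, rfl⟩ := List.append_of_mem (List.mem_toFinset.1 hx)
  have hr : (s ++ x :: t) ~r (x :: (t ++ s)) := by
    have : s ++ (x :: t) ~r (x :: t) ++ s := ⟨_, List.rotate_append_length_eq _ _⟩
    simpa using this
  refine ⟨u ++ x :: (t ++ s), ?_, ?_, ?_⟩
  · simp only [List.mem_toFinset] at hd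
    grind
  · ext y; simp; tauto
  · rw [← fp_join_s14, List.formPerm_eq_of_isRotated hL hr]

lemma Cyc.fix {α : Equiv.Perm X} {A : Finset X} (h : Cyc α A) {x : X} (hx : x ∉ A) :
    α x = x := by
  obtain ⟨L, hL, rfl, rfl⟩ := h
  exact List.formPerm_apply_of_notMem (by simpa using hx)

lemma Cyc.isCycle [Fintype X] {α : Equiv.Perm X} {A : Finset X} (h : Cyc α A) (hA : 2 ≤ A.card) :
    α.IsCycle ∧ α.support.card = A.card := by
  obtain ⟨L, hL, rfl, rfl⟩ := h
  rw [List.toFinset_card_of_nodup hL] at hA ⊢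
  refine ⟨List.isCycle_formPerm hL hA, ?_⟩
  rw [List.support_formPerm_of_nodup _ hL, List.toFinset_card_of_nodup hL]
  rintro x rfl
  simp at hA

def LP (LL : List (List X)) : Equiv.Perm X := (LL.map List.formPerm).prod
def LN (LL : List (List X)) : ℕ := (LL.map (fun c => c.length + 1)).sum
def Good (LL : List (List X)) : Prop := LL.flatten.Nodup ∧ ∀ c ∈ LL, 2 ≤ c.length

@[simp] lemma LP_nil : LP ([] : List (List X)) = 1 := rfl
@[simp] lemma LN_nil : LN ([] : List (List X)) = 0 := rfl
@[simp] lemma LP_cons (c : List X) (R : List (List X)) : LP (c :: R) = c.formPerm * LP R := by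
  simp [LP]
@[simp] lemma LN_cons (c : List X) (R : List (List X)) : LN (c :: R) = c.length + 1 + LN R := by
  simp [LN]
lemma LP_append (R S : List (List X)) : LP (R ++ S) = LP R * LP S := by simp [LP]
lemma LN_append (R S : List (List X)) : LN (R ++ S) = LN R + LN S := by simp [LN]

lemma good_cons (c : List X) (R : List (List X)) : Good (c :: R) ↔
    c.Nodup ∧ 2 ≤ c.length ∧ (∀ x ∈ c, x ∉ R.flatten) ∧ Good R := by
  simp only [Good, List.flatten_cons, List.nodup_append', List.mem_cons, forall_eq_or_imp,
    List.Disjoint]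
  tauto

lemma split_len {c : List X} {p : ℕ} (h : p < c.length) :
    ∃ u a w, c = u ++ a :: w ∧ u.length = p := by
  refine ⟨c.take p, c.get ⟨p, h⟩, c.drop (p+1), ?_, by simp; omega⟩
  simp

lemma two_cyc (LL : List (List X)) (hG : Good LL) (hne : LL ≠ []) (a b : ℕ)
    (hab : a + b = LN LL) (h1 : a ≤ b + 1) (h2 : b ≤ a + 1) :
    ∃ α β A B x, Cyc α A ∧ Cyc β B ∧ A.card = a ∧ B.card = b ∧ x ∈ A ∧ x ∈ B ∧
      (∀ y, y ∈ A ∨ y ∈ B → y ∈ LL.flatten) ∧ α * β = LP LL := by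
  induction LL generalizing a b with
  | nil => exact absurd rfl hne
  | cons c R ih =>
    obtain ⟨hc, hc2, hd, hR⟩ := (good_cons c R).1 hG
    rw [LN_cons] at hab
    rcases eq_or_ne R [] with rfl | hRne
    · simp at hab
      obtain ⟨u, x, w, rfl, hu⟩ := split_len (c := c) (p := a - 1) (by omega)
      have n1 : (u ++ [x]).Nodup := hc.sublist (by simp)
      have n2 : (x :: w).Nodup := hc.sublist (by simp)
      refine ⟨_, _, _, _, x, ⟨u ++ [x], n1, rfl, rfl⟩, ⟨x :: w, n2, rfl, rfl⟩, ?_, ?_, ?_, ?_, ?_, ?_⟩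
      · rw [List.toFinset_card_of_nodup n1]; simp; omega
      · rw [List.toFinset_card_of_nodup n2]; simp at hab ⊢; omega
      · simp
      · simp
      · intro y; simp; tauto
      · simp [fp_join_s14]
    · obtain ⟨a', b', ha', hb', e, i1, i2⟩ : ∃ a' b', a' < a ∧ b' < b ∧ a' + b' = LN R ∧
          a' ≤ b' + 1 ∧ b' ≤ a' + 1 :=
        ⟨LN R / 2, LN R - LN R / 2, by omega, by omega, by omega, by omega, by omega⟩
      obtain ⟨α, β, A, B, x, hA, hB, cA, cB, xA, xB, hs, hp⟩ := ih hR hRne a' b' e i1 i2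
      obtain ⟨u, y, w, rfl, hu⟩ := split_len (c := c) (p := a - a' - 1) (by omega)
      have n1 : (u ++ [y]).Nodup := hc.sublist (by simp)
      have n2 : (y :: w).Nodup := hc.sublist (by simp)
      have dA : ∀ z ∈ u ++ y :: w, z ∉ A := fun z hz hz' => hd z hz (hs z (Or.inl hz'))
      have dB : ∀ z ∈ u ++ y :: w, z ∉ B := fun z hz hz' => hd z hz (hs z (Or.inr hz'))
      have d1 : ∀ z ∈ u ++ [y], z ∉ A := fun z hz => dA z (by simp at hz ⊢; tauto)
      have d2 : ∀ z ∈ y :: w, z ∉ B := fun z hz => dB z (by simp at hz ⊢; tauto)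
      refine ⟨_, _, _, _, x, hA.right xA n1 d1, hB.left xB n2 d2, ?_, ?_, ?_, ?_, ?_, ?_⟩
      · rw [Finset.card_union_of_disjoint, List.toFinset_card_of_nodup n1]
        · simp; omega
        · rw [Finset.disjoint_left]; intro z hz hz'; exact d1 z (List.mem_toFinset.1 hz') hz
      · rw [Finset.card_union_of_disjoint, List.toFinset_card_of_nodup n2]
        · simp at hab ⊢; omega
        · rw [Finset.disjoint_left]; intro z hz hz'; exact d2 z (List.mem_toFinset.1 hz') hz
      · simp [xA]
      · simp [xB]
      · intro z
        have := hs z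
        simp at this ⊢; tauto
      · have nn : (x :: (u ++ y :: w)).Nodup := by
          rw [List.nodup_cons]; exact ⟨fun h => dA x h xA, hc⟩
        have key := fp_two u w x y nn
        have comm : α * (u ++ y :: w).formPerm = (u ++ y :: w).formPerm * α := by
          apply Equiv.Perm.Disjoint.commute
          intro z
          by_cases hz : z ∈ u ++ y :: w
          · exact Or.inl (hA.fix (dA z hz))
          · exact Or.inr (List.formPerm_apply_of_notMem hz)
        rw [LP_cons, ← hp, ← mul_assoc (u ++ y :: w).formPerm, ← comm, ← key]
        simp only [mul_assoc]

lemma extend_pair [Fintype X] (σ : Equiv.Perm X) (a l : ℕ) (hl : l ≤ Fintype.card X) (hal : a ≤ l)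
    (ha : 1 ≤ a)
    (h : ∃ α β A B, Cyc α A ∧ Cyc β B ∧ A.card = a ∧ B.card = a ∧ α * β = σ) :
    ∃ α β A B, Cyc α A ∧ Cyc β B ∧ A.card = l ∧ B.card = l ∧ α * β = σ := by
  induction l, hal using Nat.le_induction with
  | base => exact h
  | succ m hm ih =>
    obtain ⟨α, β, A, B, hA, hB, cA, cB, hp⟩ := ih (by omega)
    have key : ∃ x y, x ∈ A ∧ y ∉ A ∧ ((x ∈ B ∧ y ∉ B) ∨ (y ∈ B ∧ x ∉ B)) := by
      by_cases hAB : A = B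
      · subst hAB
        obtain ⟨x, hx⟩ := Finset.card_pos.1 (by omega : 0 < A.card)
        obtain ⟨y, hy⟩ : ∃ y, y ∉ A := by
          by_contra hcon
          push Not at hcon
          have : A = Finset.univ := Finset.eq_univ_iff_forall.2 hcon
          rw [this, Finset.card_univ] at cA
          omega
        exact ⟨x, y, hx, hy, Or.inl ⟨hx, hy⟩⟩
      · have h1 : ¬ A ⊆ B := fun hs => hAB (Finset.eq_of_subset_of_card_le hs (by omega))
        have h2 : ¬ B ⊆ A := fun hs => hAB (Finset.eq_of_subset_of_card_le hs (by omega)).symm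
        obtain ⟨x, hx, hx'⟩ := Finset.not_subset.1 h1
        obtain ⟨y, hy, hy'⟩ := Finset.not_subset.1 h2
        exact ⟨x, y, hx, hy', Or.inr ⟨hy, hx'⟩⟩
    obtain ⟨x, y, xA, yA, hxy⟩ := key
    have e1 : Cyc (α * Equiv.swap x y) (insert y A) := by
      have := hA.right xA (u := [y]) (by simp) (by simpa using yA)
      simpa [Finset.union_comm A] using this
    rcases hxy with ⟨xB, yB⟩ | ⟨yB, xB⟩
    · have e2 : Cyc (Equiv.swap y x * β) (insert y B) := by
        have := hB.left xB (u := [y]) (by simp) (by simpa using yB)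
        simpa [Finset.union_comm B] using this
      refine ⟨_, _, _, _, e1, e2, by simp [yA, cA], by simp [yB, cB], ?_⟩
      rw [Equiv.swap_comm y x, mul_assoc, ← mul_assoc (Equiv.swap x y)]; simp [hp]
    · have e2 : Cyc (Equiv.swap x y * β) (insert x B) := by
        have := hB.left yB (u := [x]) (by simp) (by simpa using xB)
        simpa [Finset.union_comm B] using this
      refine ⟨_, _, _, _, e1, e2, by simp [yA, cA], by simp [xB, cB], ?_⟩
      rw [mul_assoc, ← mul_assoc (Equiv.swap x y)]; simp [hp]

def QP [Fintype X] (k l : ℕ) (σ : Equiv.Perm X) : Prop :=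
  ∃ C : List (Equiv.Perm X), C.length = k ∧ (∀ c ∈ C, c.IsCycle ∧ c.support.card = l) ∧ C.prod = σ

lemma QP.mul [Fintype X] {k k' l : ℕ} {σ τ : Equiv.Perm X} (h : QP k l σ) (h' : QP k' l τ) :
    QP (k + k') l (σ * τ) := by
  obtain ⟨C, h1, h2, h3⟩ := h
  obtain ⟨D, i1, i2, i3⟩ := h'
  refine ⟨C ++ D, by simp [h1, i1], ?_, by simp [h3, i3]⟩
  intro c hc
  rcases List.mem_append.1 hc with hc | hc
  · exact h2 c hc
  · exact i2 c hc

lemma qp_two [Fintype X] (LL : List (List X)) (hG : Good LL) (l : ℕ) (hl2 : 2 ≤ l)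
    (hl : l ≤ Fintype.card X) (he : Even (LN LL)) (hN : LN LL ≤ 2 * l) : QP 2 l (LP LL) := by
  have : ∃ α β A B, Cyc α A ∧ Cyc β B ∧ A.card = l ∧ B.card = l ∧ α * β = LP LL := by
    rcases eq_or_ne LL [] with rfl | hne
    · apply extend_pair _ 1 l hl (by omega) le_rfl
      have : 0 < Fintype.card X := by omega
      obtain ⟨x⟩ := Fintype.card_pos_iff.1 this
      exact ⟨1, 1, {x}, {x}, ⟨[x], by simp⟩, ⟨[x], by simp⟩, by simp⟩
    · obtain ⟨a, ha⟩ := he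
      have : 1 ≤ a := by
        cases LL with
        | nil => exact absurd rfl hne
        | cons c R => rw [LN_cons] at ha; omega
      apply extend_pair _ a l hl (by omega) this
      obtain ⟨α, β, A, B, x, hA, hB, cA, cB, -, -, -, hp⟩ :=
        two_cyc LL hG hne a a ha.symm (by omega) (by omega)
      exact ⟨α, β, A, B, hA, hB, cA, cB, hp⟩
  obtain ⟨α, β, A, B, hA, hB, cA, cB, hp⟩ := this
  refine ⟨[α, β], rfl, ?_, by simpa using hp⟩
  have h1 := hA.isCycle (by omega)
  have h2 := hB.isCycle (by omega)
  rw [cA] at h1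
  rw [cB] at h2
  simp only [List.mem_cons, List.not_mem_nil, or_false, forall_eq_or_imp, forall_eq]
  exact ⟨h1, h2⟩

lemma splitting (LL : List (List X)) (hG : Good LL) (t : ℕ) (ht : t ≠ 1) (hN : t < LN LL) :
    ∃ L1 L2, Good L1 ∧ Good L2 ∧ LP L1 * LP L2 = LP LL ∧ LN L1 ≤ t ∧ LN L2 + t ≤ LN LL + 2 ∧
      LN L1 % 2 = t % 2 ∧ (LN L1 + LN L2) % 2 = LN LL % 2 ∧
      (∀ x ∈ L1.flatten, x ∈ LL.flatten) := by
  induction LL generalizing t with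
  | nil => simp at hN
  | cons c R ih =>
    have gnil : Good ([] : List (List X)) := by simp [Good]
    have hG' := hG
    obtain ⟨hc, hc2, hd, hR⟩ := (good_cons c R).1 hG
    rcases Nat.lt_or_ge 2 t with ht2 | ht2
    swap
    · refine ⟨[], c :: R, gnil, hG, by simp, by simp, by omega, by simp; omega, by simp, by simp⟩
    rw [LN_cons] at hN ⊢
    rcases Nat.lt_or_ge t (c.length + 1) with hlt | hge
    · obtain ⟨u, x, v, rfl, hu⟩ := split_len (c := c) (p := t - 2) (by omega)
      refine ⟨[u ++ [x]], (x :: v) :: R, ?_, ?_, ?_, ?_, ?_, ?_, ?_, ?_⟩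
      · rw [good_cons]
        refine ⟨hc.sublist (by simp), by simp; omega, by simp, gnil⟩
      · rw [good_cons]
        refine ⟨hc.sublist (by simp), ?_, ?_, hR⟩
        · simp at hlt ⊢; omega
        · intro y hy; exact hd y (by simp at hy ⊢; tauto)
      · simp only [LP_cons, LP_nil, mul_one, ← mul_assoc, fp_join_s14]
      · simp; omega
      · simp at *; omega
      · simp; omega
      · simp; omega
      · intro y; simp; tauto
    · by_cases h1 : t = c.length + 2
      · cases R with
        | nil => simp at hN; omega
        | cons e R =>
          obtain ⟨he, he2, hd', hR'⟩ := (good_cons e R).1 hR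
          obtain ⟨u, y, rfl⟩ : ∃ u y, c = u ++ [y] := by
            rcases List.eq_nil_or_concat c with h | ⟨u, y, h⟩
            · simp [h] at hc2
            · exact ⟨u, y, by simpa using h⟩
          cases e with
          | nil => simp at he2
          | cons z e =>
          have yR := hd y (by simp)
          have zu : z ∉ u ++ [y] := fun hz => hd z hz (by simp)
          refine ⟨[u ++ [y, z]], (y :: z :: e) :: R, ?_, ?_, ?_, ?_, ?_, ?_, ?_, ?_⟩
          · rw [good_cons]
            refine ⟨?_, by simp, by simp, gnil⟩
            have : (u ++ [y] ++ [z]).Nodup := by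
              rw [List.nodup_append']
              refine ⟨hc, by simp, ?_⟩
              intro w hw hw'
              simp at hw'
              exact zu (hw' ▸ hw)
            simpa using this
          · rw [good_cons]
            simp only [List.flatten_cons, List.mem_append, not_or] at yR
            refine ⟨List.nodup_cons.2 ⟨yR.1, he⟩, by simp, ?_, hR'⟩
            intro w hw
            rcases List.mem_cons.1 hw with rfl | hw
            · exact yR.2
            · exact hd' w hw
          · have e1 := fp_join_s14 u [z] y
            simp only [List.formPerm_pair] at e1
            simp only [LP_cons, LP_nil, mul_one, List.formPerm_cons_cons y z e, ← e1]
            simp only [mul_assoc, Equiv.swap_mul_self_mul]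
          · simp at *; omega
          · simp at *; omega
          · simp at *; omega
          · simp at *; omega
          · intro w; simp; tauto
      · obtain ⟨L1, L2, g1, g2, hp, n1, n2, p1, p2, hs⟩ :=
          ih hR (t - (c.length + 1)) (by omega) (by omega)
        refine ⟨c :: L1, L2, ?_, g2, ?_, ?_, ?_, ?_, ?_, ?_⟩
        · rw [good_cons]
          exact ⟨hc, hc2, fun x hx hx' => hd x hx (hs x hx'), g1⟩
        · simp [mul_assoc, hp]
        · simp; omega
        · omega
        · simp; omega
        · simp; omega
        · intro w
          simp only [List.flatten_cons, List.mem_append]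
          exact Or.imp_right (hs w)

lemma qp_all [Fintype X] (l : ℕ) (hl2 : 2 ≤ l) (hl : l ≤ Fintype.card X) (j : ℕ)
    (LL : List (List X)) (hG : Good LL) (he : Even (LN LL))
    (hN : LN LL ≤ 2 * (j + 1) * (l - 1) + 2) : QP (2 * (j + 1)) l (LP LL) := by
  induction j generalizing LL with
  | zero => exact qp_two LL hG l hl2 hl he (by omega)
  | succ j ih =>
    have e : 2 * (j + 1 + 1) = 2 + 2 * (j + 1) := by ring
    rw [e]
    have e3 : 2 * (j + 1 + 1) * (l - 1) = 2 * (j + 1) * (l - 1) + 2 * (l - 1) := by ring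
    rw [Nat.even_iff] at he
    rcases Nat.lt_or_ge (2 * l) (LN LL) with h | h
    · obtain ⟨L1, L2, g1, g2, hp, n1, n2, p1, p2, hs⟩ := splitting LL hG (2 * l) (by omega) h
      rw [← hp]
      exact (qp_two L1 g1 l hl2 hl (by rw [Nat.even_iff]; omega) n1).mul
        (ih L2 g2 (by rw [Nat.even_iff]; omega) (by omega))
    · rw [← mul_one (LP LL)]
      refine (qp_two LL hG l hl2 hl (by rw [Nat.even_iff]; omega) h).mul ?_
      exact ih [] (by simp [Good]) (by simp) (by simp)

lemma exists_lists [Fintype X] (σ : Equiv.Perm X) :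
    ∃ LL : List (List X), Good LL ∧ LP LL = σ ∧ (∀ x ∈ LL.flatten, x ∈ σ.support) ∧
      LN LL = σ.cycleType.sum + σ.cycleType.card := by
  induction σ using Equiv.Perm.cycle_induction_on with
  | base_one => exact ⟨[], by simp [Good], by simp, by simp, by simp⟩
  | base_cycles σ h =>
    obtain ⟨x, hx, -⟩ := id h
    have hc := h.cycleOf_eq hx
    have hlen : (σ.toList x).length = σ.support.card := by
      rw [Equiv.Perm.length_toList, hc]
    refine ⟨[σ.toList x], ?_, ?_, ?_, ?_⟩
    · rw [good_cons]
      exact ⟨Equiv.Perm.nodup_toList _ _,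
        by rw [hlen]; exact h.two_le_card_support, by simp, by simp [Good]⟩
    · simp [Equiv.Perm.formPerm_toList, hc]
    · intro y hy
      simp only [List.flatten_cons, List.flatten_nil, List.append_nil] at hy
      have := (Equiv.Perm.mem_toList_iff.1 hy)
      exact (this.1.mem_support_iff).1 this.2
    · simp [h.cycleType, hlen]
  | induction_disjoint σ τ hd hσ ih1 ih2 =>
    obtain ⟨L1, g1, p1, s1, n1⟩ := ih1
    obtain ⟨L2, g2, p2, s2, n2⟩ := ih2
    refine ⟨L1 ++ L2, ⟨?_, ?_⟩, ?_, ?_, ?_⟩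
    · rw [List.flatten_append, List.nodup_append']
      refine ⟨g1.1, g2.1, fun x h1 h2 => ?_⟩
      exact Finset.disjoint_left.1 hd.disjoint_support (s1 x h1) (s2 x h2)
    · intro c hc
      rcases List.mem_append.1 hc with hc | hc
      · exact g1.2 c hc
      · exact g2.2 c hc
    · rw [LP_append, p1, p2]
    · intro x hx
      rw [hd.support_mul, Finset.mem_union]
      rw [List.flatten_append, List.mem_append] at hx
      exact Or.imp (s1 x) (s2 x) hx
    · rw [LN_append, hd.cycleType_mul, n1, n2]
      simp; ring

end helpers

theorem auxiliary_hgl_l_even (k l n : ℕ) (hk : 2 ≤ k) (hke : Even k)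
    (hl3 : 3 ∣ l) (hle : Even l) (hl : 12 ≤ l) (hln : l ≤ n)
    (hn : 3 * (n - 1) ≤ 2 * k * l)
    (σ : Equiv.Perm (Fin n)) (hσ : σ ∈ alternatingGroup (Fin n))
    (hns : 3 * σ.cycleFactorsFinset.card ≤ n + 2) :
    IsProdOfCycles n k l σ := by
  obtain ⟨LL, hG, hP, -, hN⟩ := exists_lists σ
  have he : Even (LN LL) := by
    have h1 : Equiv.Perm.sign σ = 1 := Equiv.Perm.mem_alternatingGroup.1 hσ
    rw [Equiv.Perm.sign_of_cycleType, ← hN] at h1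
    by_contra hodd
    rw [Nat.not_even_iff_odd] at hodd
    rw [hodd.neg_one_pow] at h1
    exact absurd h1 (by decide)
  have hs : σ.cycleType.sum ≤ n := by
    rw [Equiv.Perm.sum_cycleType]
    simpa using Finset.card_le_univ σ.support
  have hcard : σ.cycleType.card = σ.cycleFactorsFinset.card := by
    simp [Equiv.Perm.cycleType_def]
  obtain ⟨j, rfl⟩ : ∃ j, k = 2 * (j + 1) := by
    obtain ⟨r, hr⟩ := hke
    exact ⟨r - 1, by omega⟩
  have hb : LN LL ≤ 2 * (j + 1) * (l - 1) + 2 := by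
    obtain ⟨m, rfl⟩ : ∃ m, l = m + 12 := ⟨l - 12, by omega⟩
    have e1 : 2 * (2 * (j + 1)) * (m + 12) = 4 * ((j + 1) * m) + 48 * (j + 1) := by ring
    have e2 : 2 * (j + 1) * (m + 12 - 1) = 2 * ((j + 1) * m) + 22 * (j + 1) := by
      have : m + 12 - 1 = m + 11 := by omega
      rw [this]; ring
    rw [e1] at hn
    rw [e2]
    omega
  obtain ⟨C, hC, hc, hp⟩ := qp_all l (by omega) (by simpa using hln) j LL hG he hb
  refine ⟨fun i => C.get (i.cast hC.symm), fun i => hc _ (List.get_mem _ _), ?_⟩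
  rw [← hP, ← hp]
  congr 1
  apply List.ext_getElem
  · rw [List.length_ofFn, hC]
  · intro i h1 h2
    rw [List.getElem_ofFn]
    rfl
end
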